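/- Under the same setting and hypotheses (i)–(iv) on the random LSV system and its quenched measures (γ_max < 1/3, Bernoulli 𝐏), fix α ∈ (0,2), and for m-a.e. x0 ∈ [0,1] define φ(x) := |x − x0|^{−1/α}, b := lim_{ε→0⁺} ε^{−1} ν({x : |x−x0| < ε}) and b_n := (bn)^{1/α}, where ν := ∫_Ω ν^ω d𝐏. Then for every finite disjoint union J = ⋃_{i=1}^q (u_i, v_i] with 0 < u_i < v_i ≤ ∞, setting A_n := { x : φ(x)/b_n ∈ J } and Π_α(J) := Σ_i (u_i^{−α} − v_i^{−α}), the following hold for 𝐏-a.e. ω: (a) lim_{n→∞} ν^ω( { x : T_ω^{j−1}(x) ∉ A_n for all 1 ≤ j ≤ n } ) = e^{−Π_α(J)}; (b) lim_{n→∞} Σ_{j=1}^{n} ν^{σ^{j−1} ω}(A_n) = Π_α(J). -/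

import Mathlib

open MeasureTheory Filter Set Topology ENNReal

noncomputable section

/-- The two-sided shift space on `m` symbols. -/
abbrev Om (m : ℕ) := ℤ → Fin m

/-- The left shift on the two-sided shift space. -/
def shift {m : ℕ} (ω : Om m) : Om m := fun i => ω (i + 1)

/-- The inverse of the left shift. -/
def shiftInv {m : ℕ} (ω : Om m) : Om m := fun i => ω (i - 1)

/-- Lebesgue measure on `[0,1]`. -/
def mLeb : Measure ℝ := volume.restrict (Set.Icc 0 1)

/-- The Liverani–Saussol–Vaienti intermittent map with parameter `γ`. -/
def lsv (γ : ℝ) (x : ℝ) : ℝ :=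
  if x ≤ 1 / 2 then x * (1 + 2 ^ γ * x ^ γ) else 2 * x - 1

/-- The random composition `T_ω^n = T_{ω_{n−1}} ∘ ⋯ ∘ T_{ω_0}`. -/
def randComp {m : ℕ} (T : Fin m → ℝ → ℝ) (ω : Om m) : ℕ → ℝ → ℝ
  | 0 => fun x => x
  | n + 1 => fun x => T (ω (n : ℤ)) (randComp T ω n x)

/-- The total variation distance `‖μ − ν‖` of two (finite) measures, via the
Hahn–Jordan description `‖μ − ν‖ = sup_A (μ(A) − ν(A)) + sup_A (ν(A) − μ(A))`. -/
def tvDist (μ ν : Measure ℝ) : ℝ :=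
  (⨆ A : {A : Set ℝ // MeasurableSet A}, ((μ A).toReal - (ν A).toReal)) +
  (⨆ A : {A : Set ℝ // MeasurableSet A}, ((ν A).toReal - (μ A).toReal))

/-- The `C¹` norm of `g` on `[0,1]`. -/
def C1norm (g : ℝ → ℝ) : ℝ :=
  (⨆ x : Set.Icc (0 : ℝ) 1, |g x|) + (⨆ x : Set.Icc (0 : ℝ) 1, |deriv g x|)

/-- The observable `φ(x) = |x − x0|^{−1/α}`. -/
def phiObs (α x0 x : ℝ) : ℝ := |x - x0| ^ (-α⁻¹)

/-- Membership in `J = ⋃_i (u_i, v_i]` (with `v_i = ∞` allowed). -/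
def memJ {q : ℕ} (u : Fin q → ℝ) (v : Fin q → ℝ≥0∞) (y : ℝ) : Prop :=
  ∃ i, u i < y ∧ ENNReal.ofReal y ≤ v i

/-- `Π_α(J) = Σ_i (u_i^{−α} − v_i^{−α})`. -/
def PiAlpha (α : ℝ) {q : ℕ} (u : Fin q → ℝ) (v : Fin q → ℝ≥0∞) : ℝ :=
  ∑ i, ((u i) ^ (-α) - ((v i).toReal) ^ (-α))

/-- The set `A_n = φ^{−1}(b_n J) = {x : φ(x)/b_n ∈ J}`. -/
def Aset (α x0 bn : ℝ) {q : ℕ} (u : Fin q → ℝ) (v : Fin q → ℝ≥0∞) : Set ℝ :=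
  {x | memJ u v (phiObs α x0 x / bn)}

/-- The survival event `{x : R_A(ω)(x) > N}`. -/
def survSet {m : ℕ} (T : Fin m → ℝ → ℝ) (ω : Om m) (A : Set ℝ) (N : ℕ) : Set ℝ :=
  {x | ∀ k : ℕ, 1 ≤ k → k ≤ N → randComp T ω k x ∉ A}


/-! ### Part A: basic facts on the random composition -/

lemma shift_iterate_apply {m : ℕ} (ω : Om m) (n : ℕ) (i : ℤ) : (shift^[n] ω) i = ω (i + n) := by
  induction n generalizing ω with
  | zero => simp
  | succ n ih =>
    rw [Function.iterate_succ_apply, ih]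
    simp only [shift]
    congr 1
    push_cast
    ring

lemma shiftInv_iterate_apply {m : ℕ} (ω : Om m) (n : ℕ) (i : ℤ) :
    (shiftInv^[n] ω) i = ω (i - n) := by
  induction n generalizing ω with
  | zero => simp
  | succ n ih =>
    rw [Function.iterate_succ_apply, ih]
    simp only [shiftInv]
    congr 1
    push_cast
    ring

lemma randComp_add {m : ℕ} (T : Fin m → ℝ → ℝ) (ω : Om m) (i j : ℕ) (x : ℝ) :
    randComp T ω (i + j) x = randComp T (shift^[i] ω) j (randComp T ω i x) := by
  induction j with
  | zero => rfl
  | succ j ih =>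
    rw [← add_assoc]
    simp only [randComp]
    rw [ih, shift_iterate_apply]
    congr 2
    push_cast
    ring

lemma randComp_one {m : ℕ} (T : Fin m → ℝ → ℝ) (ω : Om m) (x : ℝ) :
    randComp T ω 1 x = T (ω 0) x := rfl

lemma randComp_succ_left {m : ℕ} (T : Fin m → ℝ → ℝ) (ω : Om m) (j : ℕ) (x : ℝ) :
    randComp T ω (j + 1) x = randComp T (shift ω) j (T (ω 0) x) := by
  rw [add_comm, randComp_add, randComp_one]
  rfl

lemma randComp_congr {m : ℕ} (T : Fin m → ℝ → ℝ) (ω ω' : Om m) (n : ℕ)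
    (hh : ∀ i : ℕ, i < n → ω i = ω' i) : randComp T ω n = randComp T ω' n := by
  induction n with
  | zero => rfl
  | succ n ih =>
    funext x
    simp only [randComp]
    rw [ih (fun i hi => hh i (by omega)), hh n (by omega)]

lemma measurable_lsv (γ : ℝ) : Measurable (lsv γ) := by
  unfold lsv
  refine Measurable.ite (measurableSet_le measurable_id measurable_const) ?_ ?_
  · fun_prop
  · fun_prop

lemma measurable_randComp {m : ℕ} (T : Fin m → ℝ → ℝ) (hT : ∀ i, Measurable (T i)) (ω : Om m)
    (n : ℕ) : Measurable (randComp T ω n) := by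
  induction n with
  | zero => exact measurable_id
  | succ n ih => exact (hT _).comp ih

lemma measurable_shift {m : ℕ} : Measurable (shift : Om m → Om m) := by
  refine measurable_pi_lambda _ fun i => ?_
  exact measurable_pi_apply _

lemma measurable_randComp_joint {m : ℕ} (T : Fin m → ℝ → ℝ) (hT : ∀ i, Measurable (T i))
    (n : ℕ) : Measurable (fun p : Om m × ℝ => randComp T p.1 n p.2) := by
  induction n with
  | zero => exact measurable_snd
  | succ n ih =>
    have h1 : Measurable (fun p : Fin m × ℝ => T p.1 p.2) :=
      measurable_from_prod_countable_right fun i => hT i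
    have h2 : Measurable (fun p : Om m × ℝ => (p.1 (n : ℤ), randComp T p.1 n p.2)) := by
      refine Measurable.prodMk ?_ ih
      exact (measurable_pi_apply (n : ℤ)).comp measurable_fst
    exact h1.comp h2

lemma map_randComp {m : ℕ} (γ : Fin m → ℝ) (ν : Om m → Measure ℝ)
    (hequiv : ∀ ω : Om m, (ν ω).map (lsv (γ (ω 0))) = ν (shift ω)) (ω : Om m) (n : ℕ) :
    (ν ω).map (randComp (fun i => lsv (γ i)) ω n) = ν (shift^[n] ω) := by
  induction n with
  | zero => exact Measure.map_id
  | succ n ih =>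
    have : randComp (fun i => lsv (γ i)) ω (n + 1) =
        (lsv (γ (ω (n : ℤ)))) ∘ (randComp (fun i => lsv (γ i)) ω n) := rfl
    rw [this, ← Measure.map_map (measurable_lsv _)
      (measurable_randComp _ (fun i => measurable_lsv _) _ _), ih]
    rw [Function.iterate_succ_apply', ← hequiv, shift_iterate_apply]
    simp

lemma measure_preimage_randComp {m : ℕ} (γ : Fin m → ℝ) (ν : Om m → Measure ℝ)
    (hequiv : ∀ ω : Om m, (ν ω).map (lsv (γ (ω 0))) = ν (shift ω)) (ω : Om m) (n : ℕ)
    (V : Set ℝ) (hV : MeasurableSet V) :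
    (ν ω).real (randComp (fun i => lsv (γ i)) ω n ⁻¹' V) = (ν (shift^[n] ω)).real V := by
  rw [← map_randComp γ ν hequiv, map_measureReal_apply
    (measurable_randComp _ (fun i => measurable_lsv _) _ _) hV]

/-! ### Part B: the short return estimate -/

structure GB (δ a b : ℝ) (G : ℝ → ℝ) : Prop where
  lt : a < b
  cont : ContinuousOn G (Icc a b)
  mono : StrictMonoOn G (Icc a b)
  conv : ConvexOn ℝ (Icc a b) G
  ga : G a = 0
  gb : G b = 1
  slope : ∀ x ∈ Icc a b, ∀ y ∈ Icc a b, x < y → δ < x → (1 + 2 * δ) * (y - x) ≤ G y - G x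

lemma GB.base {δ a b r : ℝ} {G : ℝ → ℝ} (hG : GB δ a b G) (hδ : 0 < δ) (hr : 0 < r)
    (hrδ : r < δ / 2) :
    volume {x | x ∈ Ioc a b ∧ δ < x ∧ |G x - x| < r} ≤
      ENNReal.ofReal ((8 / δ + 4 / δ ^ 2) * (b - a) * r) := by
  have hL : 0 < b - a := sub_pos.2 hG.lt
  have key : ∀ x y : ℝ, x ∈ {x | x ∈ Ioc a b ∧ δ < x ∧ |G x - x| < r} →
      y ∈ {x | x ∈ Ioc a b ∧ δ < x ∧ |G x - x| < r} → x < y →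
      y - x ≤ (8 / δ + 4 / δ ^ 2) * (b - a) * r := by
    rintro x y ⟨hx, hxδ, hxr⟩ ⟨hy, hyδ, hyr⟩ hxy
    rw [abs_lt] at hxr hyr
    have e1 := hG.slope x (Ioc_subset_Icc_self hx) y (Ioc_subset_Icc_self hy) hxy hxδ
    have e2 := hG.conv.slope_mono_adjacent (left_mem_Icc.2 hG.lt.le)
      (Ioc_subset_Icc_self hy) hx.1 hxy
    rw [hG.ga, sub_zero] at e2
    have e3 : (δ / 2) / (b - a) ≤ G x / (x - a) := by
      apply div_le_div₀ <;> linarith [hx.1, hx.2]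
    have e4 := (le_div_iff₀ (sub_pos.2 hxy)).1 (e3.trans e2)
    have e5 : G y - G x < (y - x) + 2 * r := by linarith
    have hpos : 0 ≤ (8 / δ) * (b - a) * r := by positivity
    have hpos' : 0 ≤ (4 / δ ^ 2) * (b - a) * r := by positivity
    rcases le_total (b - a) (δ / 4) with hc | hc
    · have f1 : δ / 2 / (b - a) - 1 ≥ δ / (4 * (b - a)) := by
        rw [ge_iff_le, div_le_iff₀ (by positivity)]
        have : (δ / 2 / (b - a) - 1) * (4 * (b - a)) = 2 * δ - 4 * (b - a) := by
          field_simp; ring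
        rw [this]; linarith
      have f2 : δ / (4 * (b - a)) * (y - x) ≤ 2 * r := by
        have := mul_le_mul_of_nonneg_right f1 (sub_pos.2 hxy).le
        linarith
      have f3 : y - x ≤ (8 / δ) * (b - a) * r := by
        have : y - x = (δ / (4 * (b - a)) * (y - x)) * (4 * (b - a) / δ) := by
          field_simp
        rw [this]
        calc _ ≤ 2 * r * (4 * (b - a) / δ) := by gcongr
          _ = _ := by ring
      linarith
    · have f2 : δ * (y - x) ≤ r := by linarith
      have f3 : y - x ≤ r / δ := by
        rw [le_div_iff₀ hδ]; linarith
      have f4 : r / δ ≤ (4 / δ ^ 2) * (b - a) * r := by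
        have : r / δ = (4 / δ ^ 2) * (δ / 4) * r := by field_simp
        rw [this]; gcongr
      linarith
  refine (Real.volume_le_diam _).trans ?_
  refine Metric.ediam_le fun x hx y hy => ?_
  rw [edist_dist, Real.dist_eq]
  apply ENNReal.ofReal_le_ofReal
  rcases lt_trichotomy x y with hxy | hxy | hxy
  · rw [abs_sub_comm, abs_of_pos (sub_pos.2 hxy)]; exact key x y hx hy hxy
  · subst hxy; simp; positivity
  · rw [abs_of_pos (sub_pos.2 hxy)]; exact key y x hy hx hxy

def lsvL (γ x : ℝ) : ℝ := x + 2 ^ γ * x ^ (1 + γ)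

lemma lsvL_eq {γ x : ℝ} (hγ : 0 < γ) (hx : 0 ≤ x) : lsvL γ x = x * (1 + 2 ^ γ * x ^ γ) := by
  unfold lsvL
  rw [Real.rpow_add' hx (by linarith), Real.rpow_one]; ring

lemma lsvL_half {γ : ℝ} (hγ : 0 < γ) : lsvL γ (1 / 2) = 1 := by
  rw [lsvL_eq hγ (by norm_num), ← Real.mul_rpow (by norm_num) (by norm_num)]
  norm_num

lemma lsvL_zero {γ : ℝ} (hγ : 0 < γ) : lsvL γ 0 = 0 := by
  rw [lsvL_eq hγ le_rfl]; simp

lemma lsvL_slope {γ x y : ℝ} (hγ : 0 < γ) (hx : 0 ≤ x) (hxy : x ≤ y) :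
    (1 + 2 ^ γ * x ^ γ) * (y - x) ≤ lsvL γ y - lsvL γ x := by
  rw [lsvL_eq hγ hx, lsvL_eq hγ (hx.trans hxy)]
  have h1 : x ^ γ ≤ y ^ γ := Real.rpow_le_rpow hx hxy hγ.le
  have h2 : 0 < (2 : ℝ) ^ γ := by positivity
  have : 0 ≤ 2 ^ γ * y * (y ^ γ - x ^ γ) := by
    have := hx.trans hxy
    have := sub_nonneg.2 h1
    positivity
  nlinarith

lemma lsvL_slope1 {γ x y : ℝ} (hγ : 0 < γ) (hx : 0 ≤ x) (hxy : x ≤ y) :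
    (y - x) ≤ lsvL γ y - lsvL γ x := by
  have h1 := lsvL_slope hγ hx hxy
  have : 0 ≤ (2 ^ γ * x ^ γ) * (y - x) := by
    have := sub_nonneg.2 hxy
    positivity
  linarith

lemma lsvL_cont {γ : ℝ} (hγ : 0 < γ) : Continuous (lsvL γ) := by
  unfold lsvL
  have : Continuous (fun x : ℝ => x ^ (1 + γ)) := Real.continuous_rpow_const (by linarith)
  fun_prop

lemma lsvL_conv {γ : ℝ} (hγ : 0 < γ) : ConvexOn ℝ (Ici 0) (lsvL γ) := by
  unfold lsvL
  have h1 : ConvexOn ℝ (Ici 0) (fun x : ℝ => x ^ (1 + γ)) := convexOn_rpow (by linarith)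
  exact (convexOn_id (convex_Ici 0)).add (h1.smul (c := (2 : ℝ) ^ γ) (by positivity))

lemma lsv_left {γ x : ℝ} (hγ : 0 < γ) (hx : 0 ≤ x) (hx2 : x ≤ 1 / 2) : lsv γ x = lsvL γ x := by
  rw [lsvL_eq hγ hx, lsv, if_pos hx2]

lemma lsv_right {γ x : ℝ} (hx2 : 1 / 2 < x) : lsv γ x = 2 * x - 1 := by
  rw [lsv, if_neg (not_le.2 hx2)]

lemma GB.split {δ a b γ : ℝ} {G : ℝ → ℝ} (hG : GB δ a b G) (hγ : 0 < γ) :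
    ∃ c, a < c ∧ c < b ∧ G c = 1 / 2 ∧ GB δ a c (fun x => lsvL γ (G x)) ∧
      GB δ c b (fun x => 2 * G x - 1) := by
  obtain ⟨c, hc, hGc⟩ : (1 / 2 : ℝ) ∈ G '' (Icc a b) := by
    apply intermediate_value_Icc hG.lt.le hG.cont
    rw [hG.ga, hG.gb]; norm_num
  have hac : a < c := by
    rcases hc.1.eq_or_lt with h | h
    · rw [← h, hG.ga] at hGc; norm_num at hGc
    · exact h
  have hcb : c < b := by
    rcases hc.2.eq_or_lt with h | h
    · rw [h, hG.gb] at hGc; norm_num at hGc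
    · exact h
  have s1 : Icc a c ⊆ Icc a b := Icc_subset_Icc_right hcb.le
  have s2 : Icc c b ⊆ Icc a b := Icc_subset_Icc_left hac.le
  have hnn : ∀ x ∈ Icc a b, 0 ≤ G x := by
    intro x hx
    rw [← hG.ga]
    exact hG.mono.monotoneOn (left_mem_Icc.2 hG.lt.le) hx hx.1
  refine ⟨c, hac, hcb, hGc, ⟨hac, ?_, ?_, ?_, ?_, ?_, ?_⟩, ⟨hcb, ?_, ?_, ?_, ?_, ?_, ?_⟩⟩
  · exact (lsvL_cont hγ).comp_continuousOn (hG.cont.mono s1)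
  · intro x hx y hy hxy
    have := hG.mono (s1 hx) (s1 hy) hxy
    have h2 := lsvL_slope1 hγ (hnn x (s1 hx)) this.le
    simp only; linarith
  · refine ⟨convex_Icc a c, fun x hx y hy p q hp hq hpq => ?_⟩
    have h1 := hG.conv.2 (s1 hx) (s1 hy) hp hq hpq
    have hz := convex_Icc a c hx hy hp hq hpq
    have h2 := lsvL_slope1 hγ (hnn _ (s1 hz)) h1
    have h3 : 0 ≤ p • G x + q • G y := (hnn _ (s1 hz)).trans h1
    have h4 := (lsvL_conv hγ).2 (hnn x (s1 hx)) (hnn y (s1 hy)) hp hq hpq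
    simp only at *
    linarith
  · simp only [hG.ga, lsvL_zero hγ]
  · simp only [hGc, lsvL_half hγ]
  · intro x hx y hy hxy hδx
    have := hG.mono (s1 hx) (s1 hy) hxy
    have h2 := lsvL_slope1 hγ (hnn x (s1 hx)) this.le
    have h3 := hG.slope x (s1 hx) y (s1 hy) hxy hδx
    linarith
  · have := hG.cont.mono s2
    fun_prop
  · intro x hx y hy hxy
    have := hG.mono (s2 hx) (s2 hy) hxy
    simp only; linarith
  · refine ⟨convex_Icc c b, fun x hx y hy p q hp hq hpq => ?_⟩
    have h1 := hG.conv.2 (s2 hx) (s2 hy) hp hq hpq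
    simp only [smul_eq_mul] at *
    nlinarith
  · simp only [hGc]; norm_num
  · simp only [hG.gb]; norm_num
  · intro x hx y hy hxy hδx
    have := hG.mono (s2 hx) (s2 hy) hxy
    have h3 := hG.slope x (s2 hx) y (s2 hy) hxy hδx
    linarith

lemma GB.ret {m : ℕ} (γ : Fin m → ℝ) (hγ : ∀ i, 0 < γ i) {δ r : ℝ} (hδ : 0 < δ)
    (hr : 0 < r) (hrδ : r < δ / 2) (i : ℕ) : ∀ (ω : Om m) (a b : ℝ) (G : ℝ → ℝ), GB δ a b G →
    volume {x | x ∈ Ioc a b ∧ δ < x ∧ |randComp (fun i => lsv (γ i)) ω i (G x) - x| < r} ≤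
      ENNReal.ofReal ((8 / δ + 4 / δ ^ 2) * (b - a) * r) := by
  induction i with
  | zero => intro ω a b G hG; exact hG.base hδ hr hrδ
  | succ i ih =>
    intro ω a b G hG
    obtain ⟨c, hac, hcb, hGc, h1, h2⟩ := hG.split (hγ (ω 0))
    have i1 := ih (shift ω) a c _ h1
    have i2 := ih (shift ω) c b _ h2
    have hsub : {x | x ∈ Ioc a b ∧ δ < x ∧
        |randComp (fun i => lsv (γ i)) ω (i + 1) (G x) - x| < r} ⊆
        {x | x ∈ Ioc a c ∧ δ < x ∧
          |randComp (fun i => lsv (γ i)) (shift ω) i (lsvL (γ (ω 0)) (G x)) - x| < r} ∪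
        {x | x ∈ Ioc c b ∧ δ < x ∧
          |randComp (fun i => lsv (γ i)) (shift ω) i (2 * G x - 1) - x| < r} := by
      rintro x ⟨hx, hxδ, hxr⟩
      rw [randComp_succ_left] at hxr
      have hxI := Ioc_subset_Icc_self hx
      have hcI : c ∈ Icc a b := ⟨hac.le, hcb.le⟩
      rcases le_or_gt x c with hxc | hxc
      · left
        refine ⟨⟨hx.1, hxc⟩, hxδ, ?_⟩
        rw [← lsv_left (hγ _)]
        · exact hxr
        · rw [← hG.ga]
          exact hG.mono.monotoneOn (left_mem_Icc.2 hG.lt.le) hxI hx.1.le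
        · rw [← hGc]
          exact hG.mono.monotoneOn hxI hcI hxc
      · right
        refine ⟨⟨hxc, hx.2⟩, hxδ, ?_⟩
        rw [← lsv_right (γ := γ (ω 0))]
        · exact hxr
        · rw [← hGc]
          exact hG.mono hcI hxI hxc
    refine (measure_mono hsub).trans ((measure_union_le _ _).trans ((add_le_add i1 i2).trans ?_))
    have hp : 0 ≤ 8 / δ + 4 / δ ^ 2 := by positivity
    have h3 := sub_pos.2 hac
    have h4 := sub_pos.2 hcb
    rw [← ENNReal.ofReal_add (by positivity) (by positivity)]
    apply ENNReal.ofReal_le_ofReal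
    apply le_of_eq; ring

/-- The short return estimate. -/
lemma return_bound {m : ℕ} (γ : Fin m → ℝ) (hγ : ∀ i, γ i ∈ Set.Ioo (0 : ℝ) 1) {δ r : ℝ}
    (hδ : 0 < δ) (hδ2 : δ ≤ 1 / 2) (hr : 0 < r) (i : ℕ) (hi : 1 ≤ i) (ω : Om m) :
    volume {x | x ∈ Ioc (0 : ℝ) 1 ∧ δ < x ∧ |randComp (fun i => lsv (γ i)) ω i x - x| < r} ≤
      ENNReal.ofReal ((8 / δ + 4 / δ ^ 2) * r) := by
  have hK : 2 / δ ≤ 8 / δ + 4 / δ ^ 2 := by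
    have : 2 / δ ≤ 8 / δ := by gcongr; norm_num
    have : 0 ≤ 4 / δ ^ 2 := by positivity
    linarith
  rcases lt_or_ge r (δ / 2) with hrδ | hrδ
  · obtain ⟨i, rfl⟩ : ∃ j, i = j + 1 := ⟨i - 1, by omega⟩
    have g0 : 0 < γ (ω 0) := (hγ _).1
    have h2 : GB δ 0 (1 / 2) (lsvL (γ (ω 0))) := by
      refine ⟨by norm_num, (lsvL_cont g0).continuousOn, ?_, ?_, lsvL_zero g0, lsvL_half g0, ?_⟩
      · intro x hx y hy hxy
        have h2 := lsvL_slope1 g0 hx.1 hxy.le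
        linarith
      · exact (lsvL_conv g0).subset Icc_subset_Ici_self (convex_Icc _ _)
      · intro x hx y hy hxy hδx
        have h2 := lsvL_slope g0 hx.1 hxy.le
        refine le_trans ?_ h2
        have : 2 * δ ≤ 2 ^ (γ (ω 0)) * x ^ (γ (ω 0)) := by
          rw [← Real.mul_rpow (by norm_num) hx.1]
          calc 2 * δ ≤ 2 * x := by linarith
            _ = (2 * x) ^ (1 : ℝ) := by simp
            _ ≤ _ := Real.rpow_le_rpow_of_exponent_ge (by linarith) (by linarith [hx.2]) (hγ _).2.le
        have := sub_pos.2 hxy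
        gcongr
    have h3 : GB δ (1 / 2) 1 (fun x => 2 * x - 1) := by
      refine ⟨by norm_num, by fun_prop, ?_, ?_, by norm_num, by norm_num, ?_⟩
      · intro x hx y hy hxy
        simp only; linarith
      · refine ⟨convex_Icc _ _, fun x hx y hy p q hp hq hpq => ?_⟩
        simp only [smul_eq_mul]
        nlinarith
      · intro x hx y hy hxy hδx
        nlinarith
    have i1 := GB.ret γ (fun i => (hγ i).1) hδ hr hrδ i (shift ω) _ _ _ h2
    have i2 := GB.ret γ (fun i => (hγ i).1) hδ hr hrδ i (shift ω) _ _ _ h3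
    have hsub : {x | x ∈ Ioc (0 : ℝ) 1 ∧ δ < x ∧
        |randComp (fun i => lsv (γ i)) ω (i + 1) x - x| < r} ⊆
        {x | x ∈ Ioc (0 : ℝ) (1 / 2) ∧ δ < x ∧
          |randComp (fun i => lsv (γ i)) (shift ω) i (lsvL (γ (ω 0)) x) - x| < r} ∪
        {x | x ∈ Ioc (1 / 2 : ℝ) 1 ∧ δ < x ∧
          |randComp (fun i => lsv (γ i)) (shift ω) i (2 * x - 1) - x| < r} := by
      rintro x ⟨hx, hxδ, hxr⟩
      rw [randComp_succ_left] at hxr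
      rcases le_or_gt x (1 / 2) with hxc | hxc
      · left
        refine ⟨⟨hx.1, hxc⟩, hxδ, ?_⟩
        rw [← lsv_left g0 hx.1.le hxc]
        exact hxr
      · right
        refine ⟨⟨hxc, hx.2⟩, hxδ, ?_⟩
        rw [← lsv_right (γ := γ (ω 0)) hxc]
        exact hxr
    refine (measure_mono hsub).trans ((measure_union_le _ _).trans ((add_le_add i1 i2).trans ?_))
    rw [← ENNReal.ofReal_add (by positivity) (by norm_num; positivity)]
    apply ENNReal.ofReal_le_ofReal
    apply le_of_eq; ring
  · calc _ ≤ volume (Ioc (0 : ℝ) 1) := measure_mono fun x hx => hx.1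
      _ = ENNReal.ofReal 1 := by simp
      _ ≤ _ := by
        apply ENNReal.ofReal_le_ofReal
        calc (1 : ℝ) = 2 / δ * (δ / 2) := by field_simp
          _ ≤ _ := by gcongr

/-! ### Part C: short returns are negligible almost surely -/

def badS {m : ℕ} (T : Fin m → ℝ → ℝ) (δ r : ℝ) (N : ℕ) (ω : Om m) : Set ℝ :=
  {x | x ∈ Ioc (0 : ℝ) 1 ∧ δ < x ∧ ∃ i : ℕ, 1 ≤ i ∧ i < N ∧ |randComp T ω i x - x| < r}

lemma badS_bound {m : ℕ} (γ : Fin m → ℝ) (hγ : ∀ i, γ i ∈ Set.Ioo (0 : ℝ) 1) {δ r : ℝ}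
    (hδ : 0 < δ) (hδ2 : δ ≤ 1 / 2) (hr : 0 < r) (N : ℕ) (ω : Om m) :
    volume (badS (fun i => lsv (γ i)) δ r N ω) ≤
      N * ENNReal.ofReal ((8 / δ + 4 / δ ^ 2) * r) := by
  have hsub : badS (fun i => lsv (γ i)) δ r N ω ⊆ ⋃ i ∈ Finset.Ico 1 N,
      {x | x ∈ Ioc (0 : ℝ) 1 ∧ δ < x ∧ |randComp (fun i => lsv (γ i)) ω i x - x| < r} := by
    rintro x ⟨hx, hxδ, i, hi, hiN, hxr⟩
    simp only [mem_iUnion]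
    exact ⟨i, Finset.mem_Ico.2 ⟨hi, hiN⟩, hx, hxδ, hxr⟩
  calc _ ≤ ∑ i ∈ Finset.Ico 1 N, volume {x | x ∈ Ioc (0 : ℝ) 1 ∧ δ < x ∧
        |randComp (fun i => lsv (γ i)) ω i x - x| < r} :=
        (measure_mono hsub).trans (measure_biUnion_finset_le _ _)
    _ ≤ ∑ i ∈ Finset.Ico 1 N, ENNReal.ofReal ((8 / δ + 4 / δ ^ 2) * r) :=
        Finset.sum_le_sum fun i hi => return_bound γ hγ hδ hδ2 hr i (Finset.mem_Ico.1 hi).1 ω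
    _ ≤ _ := by
        rw [Finset.sum_const, nsmul_eq_mul, Nat.card_Ico]
        gcongr
        omega

lemma badS_meas {m : ℕ} (T : Fin m → ℝ → ℝ) (hT : ∀ i, Measurable (T i)) (δ r : ℝ) (N : ℕ) :
    MeasurableSet {p : Om m × ℝ | p.2 ∈ badS T δ r N p.1} := by
  have : {p : Om m × ℝ | p.2 ∈ badS T δ r N p.1} =
      (Prod.snd ⁻¹' (Ioc (0 : ℝ) 1)) ∩ ((Prod.snd ⁻¹' (Ioi δ)) ∩
        ⋃ i ∈ Finset.Ico 1 N, {p : Om m × ℝ | |randComp T p.1 i p.2 - p.2| < r}) := by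
    ext p
    simp [badS, and_assoc]
  rw [this]
  refine (measurable_snd measurableSet_Ioc).inter ((measurable_snd measurableSet_Ioi).inter ?_)
  refine Finset.measurableSet_biUnion _ fun i _ => ?_
  have h1 := measurable_randComp_joint T hT i
  have h2 : Measurable (fun p : Om m × ℝ => |randComp T p.1 i p.2 - p.2|) :=
    (h1.sub measurable_snd).abs
  exact measurableSet_lt h2 measurable_const

lemma lintegral_ball_inter (S : Set ℝ) (hS : MeasurableSet S) (r : ℝ) :
    ∫⁻ x0 : ℝ, volume ({x | |x - x0| < r} ∩ S) = ENNReal.ofReal (2 * r) * volume S := by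
  have hZ : MeasurableSet {p : ℝ × ℝ | |p.2 - p.1| < r ∧ p.2 ∈ S} := by
    refine MeasurableSet.inter ?_ (measurable_snd hS)
    exact measurableSet_lt (f := fun p : ℝ × ℝ => |p.2 - p.1|) (by fun_prop) measurable_const
  have h1 := Measure.prod_apply (μ := (volume : Measure ℝ)) (ν := (volume : Measure ℝ)) hZ
  have h2 := Measure.prod_apply_symm (μ := (volume : Measure ℝ)) (ν := (volume : Measure ℝ)) hZ
  rw [h1] at h2
  refine Eq.trans h2 ?_
  have : ∀ y : ℝ, volume ((fun x => (x, y)) ⁻¹' {p : ℝ × ℝ | |p.2 - p.1| < r ∧ p.2 ∈ S}) =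
      S.indicator (fun _ => ENNReal.ofReal (2 * r)) y := by
    intro y
    by_cases hy : y ∈ S
    · rw [indicator_of_mem hy]
      have : (fun x => (x, y)) ⁻¹' {p : ℝ × ℝ | |p.2 - p.1| < r ∧ p.2 ∈ S} = Metric.ball y r := by
        ext x
        simp [hy, Real.dist_eq, abs_sub_comm]
      rw [this, Real.volume_ball]
    · rw [indicator_of_notMem hy]
      have : (fun x => (x, y)) ⁻¹' {p : ℝ × ℝ | |p.2 - p.1| < r ∧ p.2 ∈ S} = ∅ := by
        ext x
        simp [hy]
      rw [this]; simp
  simp_rw [this]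
  rw [lintegral_indicator hS]
  simp

lemma measurable_shift_iter {m : ℕ} (j : ℕ) : Measurable (shift^[j] : Om m → Om m) :=
  measurable_shift.iterate j

lemma ae_returns {m : ℕ} (γ : Fin m → ℝ) (hγ : ∀ i, γ i ∈ Set.Ioo (0 : ℝ) 1)
    (P : Measure (Om m)) [IsProbabilityMeasure P] (t : ℕ → ℕ)
    (ht : Summable fun l : ℕ => (t (2 ^ (l + 1)) : ℝ) / 2 ^ l) (R : ℝ) (hR : 0 < R) (δ : ℝ)
    (hδ : 0 < δ) (hδ2 : δ ≤ 1 / 2) :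
    ∀ᵐ x0 : ℝ, ∀ᵐ ω ∂P, Tendsto (fun l : ℕ => ∑ j ∈ Finset.range (2 ^ (l + 1)),
      volume ({x | |x - x0| < R / 2 ^ l} ∩
        badS (fun i => lsv (γ i)) δ (2 * (R / 2 ^ l)) (t (2 ^ (l + 1))) (shift^[j] ω)))
      atTop (𝓝 0) := by
  set T : Fin m → ℝ → ℝ := fun i => lsv (γ i) with hTdef
  have hT : ∀ i, Measurable (T i) := fun i => measurable_lsv _
  set K := 8 / δ + 4 / δ ^ 2 with hK
  have hKpos : 0 < K := by positivity
  set I : ℕ → ℝ → Om m → ℝ≥0∞ := fun l x0 ω => ∑ j ∈ Finset.range (2 ^ (l + 1)),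
      volume ({x | |x - x0| < R / 2 ^ l} ∩
        badS T δ (2 * (R / 2 ^ l)) (t (2 ^ (l + 1))) (shift^[j] ω)) with hI
  have hImeas : ∀ l, Measurable (fun p : ℝ × Om m => I l p.1 p.2) := by
    intro l
    simp only [hI]
    refine Finset.measurable_sum _ fun j _ => ?_
    have hZ : MeasurableSet {p : (ℝ × Om m) × ℝ | |p.2 - p.1.1| < R / 2 ^ l ∧
        p.2 ∈ badS T δ (2 * (R / 2 ^ l)) (t (2 ^ (l + 1))) (shift^[j] p.1.2)} := by
      refine MeasurableSet.inter ?_ ?_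
      · exact measurableSet_lt (f := fun p : (ℝ × Om m) × ℝ => |p.2 - p.1.1|) (by fun_prop)
          measurable_const
      · have h1 : Measurable (fun p : (ℝ × Om m) × ℝ => (shift^[j] p.1.2, p.2)) :=
          ((measurable_shift_iter j).comp (measurable_snd.comp measurable_fst)).prodMk
            measurable_snd
        exact h1 (badS_meas T hT δ (2 * (R / 2 ^ l)) (t (2 ^ (l + 1))))
    exact measurable_measure_prodMk_left hZ
  have hIint : ∀ l ω, ∫⁻ x0, I l x0 ω ≤
      ENNReal.ofReal (8 * R ^ 2 * K * ((t (2 ^ (l + 1)) : ℝ) / 2 ^ l)) := by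
    intro l ω
    have hr : 0 < R / 2 ^ l := by positivity
    have hSm : ∀ j, MeasurableSet
        (badS T δ (2 * (R / 2 ^ l)) (t (2 ^ (l + 1))) (shift^[j] ω)) := by
      intro j
      exact measurable_prodMk_left (badS_meas T hT δ (2 * (R / 2 ^ l)) (t (2 ^ (l + 1))))
    simp only [hI]
    rw [lintegral_finsetSum']
    · calc _ ≤ ∑ j ∈ Finset.range (2 ^ (l + 1)), ENNReal.ofReal (2 * (R / 2 ^ l)) *
            ((t (2 ^ (l + 1)) : ℝ≥0∞) * ENNReal.ofReal (K * (2 * (R / 2 ^ l)))) := by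
            refine Finset.sum_le_sum fun j _ => ?_
            rw [lintegral_ball_inter _ (hSm j)]
            gcongr
            exact badS_bound γ hγ hδ hδ2 (by positivity) _ _
        _ ≤ _ := by
            rw [Finset.sum_const, nsmul_eq_mul, Finset.card_range]
            rw [← ENNReal.ofReal_natCast, ← ENNReal.ofReal_natCast (t _),
              ← ENNReal.ofReal_mul (by positivity), ← ENNReal.ofReal_mul (by positivity),
              ← ENNReal.ofReal_mul (by positivity)]
            apply ENNReal.ofReal_le_ofReal
            apply le_of_eq
            push_cast
            rw [pow_succ]
            field_simp
            ring
    · intro j _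
      refine Measurable.aemeasurable ?_
      have hZ : MeasurableSet {p : ℝ × ℝ | |p.2 - p.1| < R / 2 ^ l ∧
          p.2 ∈ badS T δ (2 * (R / 2 ^ l)) (t (2 ^ (l + 1))) (shift^[j] ω)} := by
        refine MeasurableSet.inter ?_ (measurable_snd (hSm j))
        exact measurableSet_lt (f := fun p : ℝ × ℝ => |p.2 - p.1|) (by fun_prop) measurable_const
      exact measurable_measure_prodMk_left hZ
  have hfin : ∫⁻ x0, ∫⁻ ω, ∑' l, I l x0 ω ∂P ≠ ∞ := by
    have e1 : ∫⁻ x0, ∫⁻ ω, ∑' l, I l x0 ω ∂P = ∑' l, ∫⁻ ω, (∫⁻ x0, I l x0 ω) ∂P := by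
      have : ∀ x0, ∫⁻ ω, ∑' l, I l x0 ω ∂P = ∑' l, ∫⁻ ω, I l x0 ω ∂P := by
        intro x0
        rw [lintegral_tsum]
        intro l
        exact ((hImeas l).comp measurable_prodMk_left).aemeasurable
      simp_rw [this]
      rw [lintegral_tsum]
      · congr 1
        funext l
        rw [lintegral_lintegral_swap]
        exact (hImeas l).aemeasurable
      · intro l
        exact (Measurable.lintegral_prod_right (hImeas l)).aemeasurable
    rw [e1]
    refine ne_top_of_le_ne_top ?_ (ENNReal.tsum_le_tsum (g := fun l =>
      ENNReal.ofReal (8 * R ^ 2 * K * ((t (2 ^ (l + 1)) : ℝ) / 2 ^ l))) fun l => ?_)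
    · exact (ht.mul_left _).tsum_ofReal_ne_top
    · calc _ ≤ ∫⁻ ω, ENNReal.ofReal (8 * R ^ 2 * K * ((t (2 ^ (l + 1)) : ℝ) / 2 ^ l)) ∂P :=
            lintegral_mono fun ω => hIint l ω
        _ = _ := by simp
  have hm1 : Measurable (fun p : ℝ × Om m => ∑' l, I l p.1 p.2) :=
    Measurable.ennreal_tsum hImeas
  have h1 := ae_lt_top (Measurable.lintegral_prod_right hm1) hfin
  filter_upwards [h1] with x0 hx0
  have h2 := ae_lt_top (hm1.comp measurable_prodMk_left) hx0.ne
  filter_upwards [h2] with ω hω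
  exact ENNReal.tendsto_atTop_zero_of_tsum_ne_top hω.ne

/-! ### Part D: density estimates -/

structure Dens (g a : ℝ) (μ : Measure ℝ) (h : ℝ → ℝ) : Prop where
  hg : 0 < g
  ha : 0 < a
  meas : Measurable h
  dens : μ = mLeb.withDensity (fun x => ENNReal.ofReal (h x))
  nonneg : ∀ x, 0 ≤ h x
  anti : AntitoneOn h (Set.Ioc 0 1)
  mono : MonotoneOn (fun x => x ^ (g + 1) * h x) (Set.Ioc 0 1)
  bound : ∀ x ∈ Set.Ioc (0 : ℝ) 1, h x ≤ a * x ^ (-g)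

lemma Dens.apply_eq {g a : ℝ} {μ : Measure ℝ} {h : ℝ → ℝ} (D : Dens g a μ h) {B : Set ℝ}
    (hB : MeasurableSet B) :
    μ B = ∫⁻ x in B ∩ Icc 0 1, ENNReal.ofReal (h x) := by
  rw [D.dens, withDensity_apply _ hB, mLeb, Measure.restrict_restrict hB]

lemma Dens.le {g a : ℝ} {μ : Measure ℝ} {h : ℝ → ℝ} (D : Dens g a μ h) {δ : ℝ} (hδ : 0 < δ)
    {B : Set ℝ} (hB : MeasurableSet B) (hBδ : B ⊆ Ioi δ) :
    μ B ≤ ENNReal.ofReal (a * δ ^ (-g)) * volume (B ∩ Icc 0 1) := by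
  rw [D.apply_eq hB]
  calc _ ≤ ∫⁻ x in B ∩ Icc 0 1, ENNReal.ofReal (a * δ ^ (-g)) := by
        refine setLIntegral_mono' (hB.inter measurableSet_Icc) fun x hx => ?_
        apply ENNReal.ofReal_le_ofReal
        have hxδ : δ < x := hBδ hx.1
        refine (D.bound x ⟨hδ.trans hxδ, hx.2.2⟩).trans ?_
        refine mul_le_mul_of_nonneg_left ?_ D.ha.le
        exact Real.rpow_le_rpow_of_nonpos hδ hxδ.le (by linarith [D.hg])
    _ = _ := by simp

lemma Dens.real_le {g a : ℝ} {μ : Measure ℝ} {h : ℝ → ℝ} (D : Dens g a μ h) {δ : ℝ} (hδ : 0 < δ)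
    {B : Set ℝ} (hB : MeasurableSet B) (hBδ : B ⊆ Ioi δ) :
    μ.real B ≤ (a * δ ^ (-g)) * (volume (B ∩ Icc 0 1)).toReal := by
  have h1 := D.le hδ hB hBδ
  have hfin : volume (B ∩ Icc (0 : ℝ) 1) ≠ ∞ := by
    refine ne_top_of_le_ne_top ?_ (measure_mono inter_subset_right)
    simp
  have h2 := ENNReal.toReal_mono (ENNReal.mul_ne_top ENNReal.ofReal_ne_top hfin) h1
  rw [ENNReal.toReal_mul, ENNReal.toReal_ofReal] at h2
  · exact h2
  · have := D.ha
    positivity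

lemma Dens.Ioc_le {g a : ℝ} {μ : Measure ℝ} {h : ℝ → ℝ} (D : Dens g a μ h) {δ : ℝ} (hδ : 0 < δ)
    {c d : ℝ} (hc : δ ≤ c) (hcd : c ≤ d) :
    μ.real (Ioc c d) ≤ (a * δ ^ (-g)) * (d - c) := by
  refine (D.real_le hδ measurableSet_Ioc fun x hx => lt_of_le_of_lt hc hx.1).trans ?_
  have := D.ha
  gcongr
  calc _ ≤ (volume (Ioc c d)).toReal :=
        ENNReal.toReal_mono (by simp) (measure_mono inter_subset_left)
    _ = _ := by simp [hcd]

lemma Dens.ac {g a : ℝ} {μ : Measure ℝ} {h : ℝ → ℝ} (D : Dens g a μ h) : μ ≪ volume := by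
  rw [D.dens]
  exact (withDensity_absolutelyContinuous _ _).trans Measure.absolutelyContinuous_restrict

lemma Dens.singleton {g a : ℝ} {μ : Measure ℝ} {h : ℝ → ℝ} (D : Dens g a μ h) (x : ℝ) :
    μ {x} = 0 := D.ac (by simp)

lemma Dens.osc {g a : ℝ} {μ : Measure ℝ} {h : ℝ → ℝ} (D : Dens g a μ h) {x0 x : ℝ}
    (hx0 : x0 ∈ Ioc (0 : ℝ) 1) (hx : x ∈ Ioc (0 : ℝ) 1) :
    |h x - h x0| ≤ |(x0 / x) ^ (g + 1) - 1| * (a * x0 ^ (-g)) := by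
  have hb := D.bound x0 hx0
  have hn := D.nonneg x0
  have hxp : 0 < x ^ (g + 1) := Real.rpow_pos_of_pos hx.1 _
  have hdiv : (x0 / x) ^ (g + 1) = x0 ^ (g + 1) / x ^ (g + 1) := Real.div_rpow hx0.1.le hx.1.le _
  suffices hs : |h x - h x0| ≤ |(x0 / x) ^ (g + 1) - 1| * h x0 from
    hs.trans (mul_le_mul_of_nonneg_left hb (abs_nonneg _))
  rcases le_total x x0 with hxx | hxx
  · have h1 := D.anti hx hx0 hxx
    have h2 := D.mono hx hx0 hxx
    simp only at h2
    have h3 : h x ≤ (x0 / x) ^ (g + 1) * h x0 := by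
      rw [hdiv, div_mul_eq_mul_div, le_div_iff₀ hxp]; linarith
    rw [abs_of_nonneg (by linarith)]
    calc h x - h x0 ≤ ((x0 / x) ^ (g + 1) - 1) * h x0 := by linarith
      _ ≤ _ := mul_le_mul_of_nonneg_right (le_abs_self _) hn
  · have h1 := D.anti hx0 hx hxx
    have h2 := D.mono hx0 hx hxx
    simp only at h2
    have h3 : (x0 / x) ^ (g + 1) * h x0 ≤ h x := by
      rw [hdiv, div_mul_eq_mul_div, div_le_iff₀ hxp]; linarith
    rw [abs_of_nonpos (by linarith)]
    calc -(h x - h x0) ≤ (-((x0 / x) ^ (g + 1) - 1)) * h x0 := by linarith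
      _ ≤ _ := mul_le_mul_of_nonneg_right (neg_le_abs _) hn

lemma osc_modulus {g a x0 : ℝ} (hx0 : x0 ∈ Ioo (0 : ℝ) 1) {η : ℝ}
    (hη : 0 < η) : ∃ s0 > 0, ∀ x, |x - x0| < s0 → x ∈ Ioc (0 : ℝ) 1 ∧
      |(x0 / x) ^ (g + 1) - 1| * (a * x0 ^ (-g)) ≤ η := by
  have hc : ContinuousAt (fun x : ℝ => |(x0 / x) ^ (g + 1) - 1| * (a * x0 ^ (-g))) x0 := by
    have h1 : ContinuousAt (fun x : ℝ => x0 / x) x0 :=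
      continuousAt_const.div continuousAt_id hx0.1.ne'
    have h2 : ContinuousAt (fun x : ℝ => (x0 / x) ^ (g + 1)) x0 := by
      refine h1.rpow_const (Or.inl ?_)
      simp [hx0.1.ne']
    exact ((h2.sub continuousAt_const).abs).mul continuousAt_const
  have h0 : |(x0 / x0) ^ (g + 1) - 1| * (a * x0 ^ (-g)) < η := by
    rw [div_self hx0.1.ne']; simpa using hη
  have e1 := hc.eventually (gt_mem_nhds h0)
  have e2 : ∀ᶠ x in 𝓝 x0, x ∈ Ioo (0 : ℝ) 1 := isOpen_Ioo.mem_nhds hx0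
  obtain ⟨s0, hs0, hb⟩ := Metric.eventually_nhds_iff.1 (e1.and e2)
  refine ⟨s0, hs0, fun x hx => ?_⟩
  have := hb (y := x) (by rwa [Real.dist_eq])
  exact ⟨Ioo_subset_Ioc_self this.2, this.1.le⟩

lemma Dens.ball {g a : ℝ} {μ : Measure ℝ} [IsProbabilityMeasure μ] {h : ℝ → ℝ}
    (D : Dens g a μ h) {x0 s η : ℝ}
    (hx0 : x0 ∈ Ioo (0 : ℝ) 1) (hη : 0 < η) (hs : 0 ≤ s)
    (hb : ∀ x, |x - x0| < s → x ∈ Ioc (0 : ℝ) 1 ∧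
      |(x0 / x) ^ (g + 1) - 1| * (a * x0 ^ (-g)) ≤ η) :
    |μ.real {x | |x - x0| < s} - 2 * s * h x0| ≤ 2 * η * s := by
  have hball : {x | |x - x0| < s} = Metric.ball x0 s := by
    ext x; simp [Real.dist_eq]
  have hm : MeasurableSet {x | |x - x0| < s} := by rw [hball]; exact measurableSet_ball
  have hsub : {x | |x - x0| < s} ∩ Icc 0 1 = {x | |x - x0| < s} :=
    inter_eq_left.2 fun x hx => Ioc_subset_Icc_self (hb x hx).1
  have hosc : ∀ x, |x - x0| < s → |h x - h x0| ≤ η := fun x hx =>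
    (D.osc (Ioo_subset_Ioc_self hx0) (hb x hx).1).trans (hb x hx).2
  have hvol : volume {x | |x - x0| < s} = ENNReal.ofReal (2 * s) := by
    rw [hball, Real.volume_ball]
  have e0 := D.apply_eq hm
  rw [hsub] at e0
  have up : μ {x | |x - x0| < s} ≤ ENNReal.ofReal ((h x0 + η) * (2 * s)) := by
    rw [e0]
    calc _ ≤ ∫⁻ x in {x | |x - x0| < s}, ENNReal.ofReal (h x0 + η) := by
          refine setLIntegral_mono' hm fun x hx => ENNReal.ofReal_le_ofReal ?_
          have := (abs_le.1 (hosc x hx)).2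
          linarith
      _ = _ := by
          rw [setLIntegral_const, hvol, ← ENNReal.ofReal_mul]
          have := D.nonneg x0
          linarith
  have lo : ENNReal.ofReal ((h x0 - η) * (2 * s)) ≤ μ {x | |x - x0| < s} := by
    rw [e0]
    calc _ = ∫⁻ x in {x | |x - x0| < s}, ENNReal.ofReal (h x0 - η) := by
          rw [setLIntegral_const, hvol, ← ENNReal.ofReal_mul' (by linarith)]
      _ ≤ _ := by
          refine setLIntegral_mono' hm fun x hx => ENNReal.ofReal_le_ofReal ?_
          have := (abs_le.1 (hosc x hx)).1
          linarith
  have hn := D.nonneg x0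
  have up' : μ.real {x | |x - x0| < s} ≤ (h x0 + η) * (2 * s) := by
    rw [Measure.real]
    exact ENNReal.toReal_le_of_le_ofReal (by positivity) up
  have lo' : (h x0 - η) * (2 * s) ≤ μ.real {x | |x - x0| < s} := by
    rw [Measure.real]
    exact (ENNReal.ofReal_le_iff_le_toReal (measure_ne_top _ _)).1 lo
  rw [abs_le]
  constructor <;> linarith

lemma Dens.pos {g a : ℝ} {μ : Measure ℝ} [IsProbabilityMeasure μ] {h : ℝ → ℝ}
    (D : Dens g a μ h) {x0 : ℝ} (hx0 : x0 ∈ Ioo (0 : ℝ) 1) : 0 < h x0 := by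
  rcases (D.nonneg x0).eq_or_lt with h0 | h0
  swap
  · exact h0
  exfalso
  have hz : ∀ x ∈ Ioc (0 : ℝ) 1, h x = 0 := by
    intro x hx
    rcases le_total x x0 with hxx | hxx
    · have h2 := D.mono hx (Ioo_subset_Ioc_self hx0) hxx
      simp only [← h0, mul_zero] at h2
      have hxp : 0 < x ^ (g + 1) := Real.rpow_pos_of_pos hx.1 _
      have := D.nonneg x
      nlinarith
    · have := D.anti (Ioo_subset_Ioc_self hx0) hx hxx
      have := D.nonneg x
      linarith
  have h1 : μ univ = 0 := by
    rw [D.apply_eq MeasurableSet.univ, univ_inter, ← restrict_Ioc_eq_restrict_Icc]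
    rw [setLIntegral_congr_fun measurableSet_Ioc (g := fun _ => 0)]
    · simp
    · intro x hx
      simp [hz x hx]
  simp at h1

/-! ### Part E: law of large numbers along the shift -/

lemma avg_of_residues (X : ℕ → ℝ) (h0 : ∀ j, 0 ≤ X j) (h1 : ∀ j, X j ≤ 1) (L : ℕ) (hL : 1 ≤ L)
    (c : ℝ) (hX : ∀ r < L, Tendsto (fun N : ℕ => (∑ i ∈ Finset.range N, X (L * i + r)) / (N : ℝ))
      atTop (𝓝 c)) :
    Tendsto (fun n : ℕ => (∑ j ∈ Finset.range n, X j) / (n : ℝ)) atTop (𝓝 c) := by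
  have hL0 : (0 : ℝ) < L := by exact_mod_cast hL
  have e1 : ∀ N : ℕ, ∑ j ∈ Finset.range (L * N), X j =
      ∑ r ∈ Finset.range L, ∑ i ∈ Finset.range N, X (L * i + r) := by
    intro N
    induction N with
    | zero => simp
    | succ N ih =>
      rw [Nat.mul_succ, Finset.sum_range_add, ih, ← Finset.sum_add_distrib]
      refine Finset.sum_congr rfl fun r _ => ?_
      rw [Finset.sum_range_succ]
  have e2 : Tendsto (fun N : ℕ => (∑ j ∈ Finset.range (L * N), X j) / (N : ℝ)) atTop
      (𝓝 (L * c)) := by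
    have := tendsto_finsetSum (Finset.range L) (fun r hr => hX r (Finset.mem_range.1 hr))
    simp only [Finset.sum_const, Finset.card_range, nsmul_eq_mul] at this
    refine this.congr fun N => ?_
    rw [e1, Finset.sum_div]
  have e3 : Tendsto (fun n : ℕ => n / L) atTop atTop := Nat.tendsto_div_const_atTop (by omega)
  have e4 := e2.comp e3
  have einv : Tendsto (fun n : ℕ => (1 : ℝ) / n) atTop (𝓝 0) := tendsto_one_div_atTop_nhds_zero_nat
  have hdm : ∀ n : ℕ, (n : ℝ) = L * ((n / L : ℕ) : ℝ) + ((n % L : ℕ) : ℝ) := by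
    intro n
    exact_mod_cast (Nat.div_add_mod n L).symm
  have hml : ∀ n : ℕ, ((n % L : ℕ) : ℝ) ≤ L := by
    intro n
    exact_mod_cast (Nat.mod_lt n (by omega)).le
  have e5 : Tendsto (fun n : ℕ => ((n / L : ℕ) : ℝ) / n) atTop (𝓝 (1 / L)) := by
    have l1 : Tendsto (fun n : ℕ => 1 / (L : ℝ) - 1 / n) atTop (𝓝 (1 / L - 0)) :=
      tendsto_const_nhds.sub einv
    rw [sub_zero] at l1
    refine tendsto_of_tendsto_of_tendsto_of_le_of_le' l1 tendsto_const_nhds ?_ ?_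
    · filter_upwards [eventually_gt_atTop 0] with n hn
      have hn' : (0 : ℝ) < n := by exact_mod_cast hn
      rw [div_sub_div _ _ hL0.ne' hn'.ne', div_le_div_iff₀ (by positivity) hn']
      have := hdm n
      have := hml n
      nlinarith
    · filter_upwards [eventually_gt_atTop 0] with n hn
      have hn' : (0 : ℝ) < n := by exact_mod_cast hn
      rw [div_le_div_iff₀ hn' hL0]
      have := hdm n
      have : (0 : ℝ) ≤ ((n % L : ℕ) : ℝ) := Nat.cast_nonneg _
      linarith
  have e6 : Tendsto (fun n : ℕ => (∑ j ∈ Finset.range (L * (n / L)), X j) / (n : ℝ)) atTop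
      (𝓝 c) := by
    have := e4.mul e5
    rw [show L * c * (1 / L) = c by field_simp] at this
    refine this.congr' ?_
    filter_upwards [eventually_ge_atTop L] with n hn
    have : (0 : ℝ) < ((n / L : ℕ) : ℝ) := by exact_mod_cast Nat.div_pos hn (by omega)
    simp only [Function.comp]
    field_simp
  have e7 : Tendsto (fun n : ℕ => (∑ j ∈ Finset.range (L * (n / L)), X j) / (n : ℝ) +
      L * (1 / n)) atTop (𝓝 c) := by
    have := e6.add (einv.const_mul (L : ℝ))
    simpa using this
  have hsplit : ∀ n, ∑ j ∈ Finset.range n, X j = ∑ j ∈ Finset.range (L * (n / L)), X j +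
      ∑ r ∈ Finset.range (n % L), X (L * (n / L) + r) := by
    intro n
    rw [← Finset.sum_range_add, Nat.div_add_mod]
  refine tendsto_of_tendsto_of_tendsto_of_le_of_le e6 e7 (fun n => ?_) (fun n => ?_)
  · simp only
    rw [hsplit n]
    gcongr
    have := Finset.sum_nonneg (s := Finset.range (n % L))
      (fun r _ => h0 (L * (n / L) + r))
    linarith
  · simp only
    rw [hsplit n, add_div]
    have : ∑ r ∈ Finset.range (n % L), X (L * (n / L) + r) ≤ L := by
      calc _ ≤ ∑ r ∈ Finset.range (n % L), (1 : ℝ) := Finset.sum_le_sum fun r _ => h1 _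
        _ ≤ L := by simpa using hml n
    rw [mul_one_div]
    gcongr

/-- cylinder sets. -/
def cyl {m : ℕ} (s : Finset ℤ) (w : ℤ → Fin m) : Set (Om m) := {ω | ∀ i ∈ s, ω i = w i}

lemma cyl_meas {m : ℕ} (s : Finset ℤ) (w : ℤ → Fin m) : MeasurableSet (cyl s w) := by
  have : cyl s w = ⋂ i ∈ s, (fun ω : Om m => ω i) ⁻¹' {w i} := by
    ext ω; simp [cyl]
  rw [this]
  exact Finset.measurableSet_biInter _ fun i _ => measurable_pi_apply i (measurableSet_singleton _)

lemma cyl_shift {m : ℕ} (s : Finset ℤ) (w : ℤ → Fin m) (j : ℕ) :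
    (shift^[j] : Om m → Om m) ⁻¹' cyl s w = cyl (s.image (fun i => i + (j : ℤ))) (fun i => w (i - j)) := by
  ext ω
  simp only [cyl, mem_preimage, mem_ofPred_eq, shift_iterate_apply, Finset.mem_image,
    forall_exists_index, and_imp, forall_apply_eq_imp_iff₂, add_sub_cancel_right]

lemma cyl_prob {m : ℕ} (p : Fin m → ℝ) (P : Measure (Om m))
    (hP : ∀ (s : Finset ℤ) (f : ℤ → Fin m),
      P {ω | ∀ i ∈ s, ω i = f i} = ENNReal.ofReal (∏ i ∈ s, p (f i)))
    (s : Finset ℤ) (w : ℤ → Fin m) (j : ℕ) :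
    P ((shift^[j] : Om m → Om m) ⁻¹' cyl s w) = P (cyl s w) := by
  rw [cyl_shift]
  unfold cyl
  rw [hP, hP]
  congr 1
  rw [Finset.prod_image (by intro a _ b _ hab; simpa using hab)]
  simp

lemma cyl_indep {m : ℕ} (p : Fin m → ℝ) (hp : ∀ i, 0 < p i) (P : Measure (Om m))
    [IsProbabilityMeasure P]
    (hP : ∀ (s : Finset ℤ) (f : ℤ → Fin m),
      P {ω | ∀ i ∈ s, ω i = f i} = ENNReal.ofReal (∏ i ∈ s, p (f i)))
    (s : Finset ℤ) (w : ℤ → Fin m) (j j' : ℕ)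
    (hd : Disjoint (s.image (fun i => i + (j : ℤ))) (s.image (fun i => i + (j' : ℤ)))) :
    ProbabilityTheory.IndepSet ((shift^[j] : Om m → Om m) ⁻¹' cyl s w)
      ((shift^[j'] : Om m → Om m) ⁻¹' cyl s w) P := by
  refine (ProbabilityTheory.indepSet_iff_measure_inter_eq_mul
    (measurable_shift_iter j (cyl_meas s w)) (measurable_shift_iter j' (cyl_meas s w)) P).2 ?_
  rw [cyl_shift, cyl_shift]
  set s1 := s.image (fun i => i + (j : ℤ))
  set s2 := s.image (fun i => i + (j' : ℤ))
  set w0 : ℤ → Fin m := fun i => if i ∈ s1 then w (i - j) else w (i - j') with hw0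
  have h1 : ∀ i ∈ s1, w0 i = w (i - j) := fun i hi => by simp [hw0, hi]
  have h2 : ∀ i ∈ s2, w0 i = w (i - j') := fun i hi => by
    have : i ∉ s1 := fun h => Finset.disjoint_left.1 hd h hi
    simp [hw0, this]
  have e : cyl s1 (fun i => w (i - j)) ∩ cyl s2 (fun i => w (i - j')) = cyl (s1 ∪ s2) w0 := by
    ext ω
    simp only [cyl, mem_inter_iff, mem_ofPred_eq, Finset.mem_union]
    constructor
    · rintro ⟨a, b⟩ i (hi | hi)
      · rw [a i hi, h1 i hi]
      · rw [b i hi, h2 i hi]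
    · intro a
      refine ⟨fun i hi => ?_, fun i hi => ?_⟩
      · rw [a i (Or.inl hi), h1 i hi]
      · rw [a i (Or.inr hi), h2 i hi]
  rw [e]
  unfold cyl
  rw [hP, hP, hP, Finset.prod_union hd, ENNReal.ofReal_mul
    (Finset.prod_nonneg fun i _ => (hp _).le)]
  congr 2
  · exact Finset.prod_congr rfl fun i hi => by rw [h1 i hi]
  · exact Finset.prod_congr rfl fun i hi => by rw [h2 i hi]

lemma cyl_lln {m : ℕ} (p : Fin m → ℝ) (hp : ∀ i, 0 < p i) (P : Measure (Om m))
    [IsProbabilityMeasure P]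
    (hP : ∀ (s : Finset ℤ) (f : ℤ → Fin m),
      P {ω | ∀ i ∈ s, ω i = f i} = ENNReal.ofReal (∏ i ∈ s, p (f i)))
    (k : ℕ) (hk : 1 ≤ k) (w : ℤ → Fin m) :
    ∀ᵐ ω ∂P, Tendsto (fun n : ℕ => (∑ j ∈ Finset.range n,
      (cyl (Finset.Ico (-(k : ℤ)) k) w).indicator (fun _ => (1 : ℝ)) (shift^[j] ω)) / (n : ℝ))
      atTop (𝓝 (P.real (cyl (Finset.Ico (-(k : ℤ)) k) w))) := by
  set s := Finset.Ico (-(k : ℤ)) k with hs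
  set E := cyl s w with hE
  have hEm : MeasurableSet E := cyl_meas s w
  set X : ℕ → Om m → ℝ := fun j => (((shift^[j] : Om m → Om m) ⁻¹' E).indicator (fun _ => (1 : ℝ)))
    with hX
  have hXE : ∀ j ω, E.indicator (fun _ => (1 : ℝ)) (shift^[j] ω) = X j ω := by
    intro j ω
    rfl
  have hEj : ∀ j : ℕ, MeasurableSet ((shift^[j] : Om m → Om m) ⁻¹' E) :=
    fun j => measurable_shift_iter j hEm
  have hXm : ∀ j, Measurable (X j) := fun j => measurable_const.indicator (hEj j)
  have hall : ∀ r : ℕ, ∀ᵐ ω ∂P, Tendsto (fun N : ℕ =>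
      (∑ i ∈ Finset.range N, X (2 * k * i + r) ω) / (N : ℝ)) atTop (𝓝 (P.real E)) := by
    intro r
    have hint : ∀ j, ∫ ω, X j ω ∂P = P.real E := by
      intro j
      simp only [hX]
      rw [integral_indicator_const _ (hEj j), smul_eq_mul, mul_one, Measure.real, Measure.real,
        cyl_prob p P hP]
    have := ProbabilityTheory.strong_law_ae_real (μ := P) (fun i => X (2 * k * i + r)) ?_ ?_ ?_
    · rw [hint] at this
      exact this
    · exact (integrable_const (1 : ℝ)).indicator (hEj _)
    · intro i i' hii
      simp only [Function.onFun]
      have hI := cyl_indep p hp P hP s w (2 * k * i + r) (2 * k * i' + r) (by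
        rw [Finset.disjoint_left]
        intro x hx hx'
        simp only [Finset.mem_image, hs, Finset.mem_Ico] at hx hx'
        obtain ⟨a, ha, rfl⟩ := hx
        obtain ⟨b, hb, hab⟩ := hx'
        push_cast at hab
        rcases lt_or_gt_of_ne hii with h | h
        · have : (i : ℤ) + 1 ≤ i' := by exact_mod_cast h
          nlinarith
        · have : (i' : ℤ) + 1 ≤ i := by exact_mod_cast h
          nlinarith)
      refine ProbabilityTheory.indep_of_indep_of_le_left
        (ProbabilityTheory.indep_of_indep_of_le_right hI ?_) ?_
      · rw [← measurable_iff_comap_le]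
        exact Measurable.indicator (m := _) measurable_const (MeasurableSpace.measurableSet_generateFrom rfl)
      · rw [← measurable_iff_comap_le]
        exact Measurable.indicator (m := _) measurable_const (MeasurableSpace.measurableSet_generateFrom rfl)
    · intro i
      refine ⟨(hXm _).aemeasurable, (hXm _).aemeasurable, ?_⟩
      ext B hB
      rw [Measure.map_apply (hXm _) hB, Measure.map_apply (hXm _) hB]
      classical
      have hpre : ∀ j, P (X j ⁻¹' B) = (if (1 : ℝ) ∈ B then P E else 0) +
          (if (0 : ℝ) ∈ B then P Eᶜ else 0) := by
        intro j
        simp only [hX]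
        have c1 : P ((shift^[j] : Om m → Om m) ⁻¹' E)ᶜ = P Eᶜ := by
          rw [prob_compl_eq_one_sub (hEj j), prob_compl_eq_one_sub hEm, cyl_prob p P hP]
        have c2 : P ((shift^[j] : Om m → Om m) ⁻¹' E) = P E := cyl_prob p P hP s w j
        by_cases b1 : (1 : ℝ) ∈ B <;> by_cases b0 : (0 : ℝ) ∈ B
        · have : ((shift^[j] : Om m → Om m) ⁻¹' E).indicator (fun _ => (1 : ℝ)) ⁻¹' B = univ := by
            ext ω; by_cases h : ω ∈ ((shift^[j] : Om m → Om m) ⁻¹' E) <;> simp_all [indicator]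
          rw [this, if_pos b1, if_pos b0, measure_add_measure_compl hEm]
        · have : ((shift^[j] : Om m → Om m) ⁻¹' E).indicator (fun _ => (1 : ℝ)) ⁻¹' B =
              ((shift^[j] : Om m → Om m) ⁻¹' E) := by
            ext ω; by_cases h : ω ∈ ((shift^[j] : Om m → Om m) ⁻¹' E) <;> simp_all [indicator]
          rw [this, if_pos b1, if_neg b0, c2, add_zero]
        · have : ((shift^[j] : Om m → Om m) ⁻¹' E).indicator (fun _ => (1 : ℝ)) ⁻¹' B =
              ((shift^[j] : Om m → Om m) ⁻¹' E)ᶜ := by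
            ext ω; by_cases h : ω ∈ ((shift^[j] : Om m → Om m) ⁻¹' E) <;> simp_all [indicator]
          rw [this, if_neg b1, if_pos b0, c1, zero_add]
        · have : ((shift^[j] : Om m → Om m) ⁻¹' E).indicator (fun _ => (1 : ℝ)) ⁻¹' B = ∅ := by
            ext ω; by_cases h : ω ∈ ((shift^[j] : Om m → Om m) ⁻¹' E) <;> simp_all [indicator]
          rw [this, if_neg b1, if_neg b0]; simp
      rw [hpre, hpre]
  filter_upwards [ae_all_iff.2 hall] with ω hω
  simp_rw [hXE]
  refine avg_of_residues (fun j => X j ω) ?_ ?_ (2 * k) (by omega) _ (fun r _ => hω r)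
  · intro j; simp only [hX, indicator]; split_ifs <;> norm_num
  · intro j; simp only [hX, indicator]; split_ifs <;> norm_num

/-- words extended by a default symbol. -/
def extW {m : ℕ} (d : Fin m) (s : Finset ℤ) (w : s → Fin m) : ℤ → Fin m :=
  fun i => if hi : i ∈ s then w ⟨i, hi⟩ else d

lemma ergodic_shift {m : ℕ} (hm : 1 ≤ m) (p : Fin m → ℝ) (hp : ∀ i, 0 < p i) (P : Measure (Om m))
    [IsProbabilityMeasure P]
    (hP : ∀ (s : Finset ℤ) (f : ℤ → Fin m),
      P {ω | ∀ i ∈ s, ω i = f i} = ENNReal.ofReal (∏ i ∈ s, p (f i)))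
    (f : Om m → ℝ)
    (hf : ∀ ε > 0, ∃ k : ℕ, 1 ≤ k ∧ ∀ ω ω' : Om m,
      (∀ i : ℤ, -(k : ℤ) ≤ i → i < k → ω i = ω' i) → |f ω - f ω'| ≤ ε) :
    Measurable f ∧ Integrable f P ∧ ∀ᵐ ω ∂P, Tendsto (fun n : ℕ =>
      (∑ j ∈ Finset.range n, f (shift^[j] ω)) / (n : ℝ)) atTop (𝓝 (∫ ω, f ω ∂P)) := by
  classical
  let d : Fin m := ⟨0, hm⟩
  have happ : ∀ ε > 0, ∃ F : Om m → ℝ, Measurable F ∧ Integrable F P ∧ (∀ ω, |f ω - F ω| ≤ ε) ∧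
      ∀ᵐ ω ∂P, Tendsto (fun n : ℕ =>
        (∑ j ∈ Finset.range n, F (shift^[j] ω)) / (n : ℝ)) atTop (𝓝 (∫ ω, F ω ∂P)) := by
    intro ε hε
    obtain ⟨k, hk, hkf⟩ := hf ε hε
    set s := Finset.Ico (-(k : ℤ)) k with hs
    let F : Om m → ℝ := fun ω => ∑ w : s → Fin m,
      f (extW d s w) * (cyl s (extW d s w)).indicator (fun _ => (1 : ℝ)) ω
    have hFterm : ∀ w : s → Fin m, Measurable (fun ω =>
        f (extW d s w) * (cyl s (extW d s w)).indicator (fun _ => (1 : ℝ)) ω) := by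
      intro w
      exact (measurable_const.indicator (cyl_meas _ _)).const_mul _
    have hFint : ∀ w : s → Fin m, Integrable (fun ω =>
        f (extW d s w) * (cyl s (extW d s w)).indicator (fun _ => (1 : ℝ)) ω) P := by
      intro w
      exact ((integrable_const (1 : ℝ)).indicator (cyl_meas _ _)).const_mul _
    refine ⟨F, Finset.measurable_sum _ fun w _ => hFterm w,
      integrable_finsetSum _ fun w _ => hFint w, ?_, ?_⟩
    · intro ω
      have hFω : F ω = f (extW d s (fun i => ω i)) := by
        simp only [F]
        rw [Finset.sum_eq_single (fun i : s => ω i)]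
        · rw [indicator_of_mem, mul_one]
          intro i hi
          simp [extW, hi]
        · intro w _ hw
          rw [indicator_of_notMem, mul_zero]
          intro hmem
          apply hw
          funext i
          have := hmem i i.2
          simp only [extW, i.2, dite_true] at this
          exact this.symm
        · intro h; exact absurd (Finset.mem_univ _) h
      rw [hFω]
      apply hkf
      intro i hi1 hi2
      have : i ∈ s := Finset.mem_Ico.2 ⟨hi1, hi2⟩
      simp [extW, this]
    · have hall : ∀ᵐ ω ∂P, ∀ w : s → Fin m, Tendsto (fun n : ℕ => (∑ j ∈ Finset.range n,
          (cyl s (extW d s w)).indicator (fun _ => (1 : ℝ)) (shift^[j] ω)) / (n : ℝ))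
          atTop (𝓝 (P.real (cyl s (extW d s w)))) :=
        ae_all_iff.2 fun w => cyl_lln p hp P hP k hk _
      filter_upwards [hall] with ω hω
      have h1 := tendsto_finsetSum Finset.univ
        (fun (w : s → Fin m) _ => (hω w).const_mul (f (extW d s w)))
      have h2 : ∫ ω, F ω ∂P = ∑ w : s → Fin m, f (extW d s w) * P.real (cyl s (extW d s w)) := by
        simp only [F]
        rw [integral_finsetSum _ fun w _ => hFint w]
        refine Finset.sum_congr rfl fun w _ => ?_
        rw [integral_const_mul, integral_indicator_const _ (cyl_meas _ _), smul_eq_mul, mul_one]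
      rw [h2]
      refine h1.congr fun n => ?_
      simp only [F]
      rw [Finset.sum_comm, Finset.sum_div]
      refine Finset.sum_congr rfl fun w _ => ?_
      rw [← Finset.mul_sum, mul_div_assoc]
  have hεq : ∀ q : ℕ, (0 : ℝ) < 1 / ((q : ℝ) + 1) := fun q => by positivity
  choose F hFm hFi hFf hFt using fun q : ℕ => happ (1 / ((q : ℝ) + 1)) (hεq q)
  have hfm : Measurable f := by
    refine measurable_of_tendsto_metrizable hFm ?_
    rw [tendsto_pi_nhds]
    intro ω
    rw [tendsto_iff_dist_tendsto_zero]
    refine squeeze_zero (fun _ => dist_nonneg) (fun q => ?_)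
      (tendsto_one_div_add_atTop_nhds_zero_nat (𝕜 := ℝ))
    rw [dist_comm, Real.dist_eq]
    exact hFf q ω
  have hfi : Integrable f P := by
    have h1 : Integrable (fun ω => f ω - F 0 ω) P :=
      Integrable.of_bound (hfm.sub (hFm 0)).aestronglyMeasurable (1 / ((0 : ℕ) + 1 : ℝ))
        (Eventually.of_forall fun ω => hFf 0 ω)
    have := h1.add (hFi 0)
    refine this.congr (Eventually.of_forall fun ω => ?_)
    simp
  refine ⟨hfm, hfi, ?_⟩
  have hint : ∀ q, |∫ ω, f ω ∂P - ∫ ω, F q ω ∂P| ≤ 1 / ((q : ℝ) + 1) := by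
    intro q
    rw [← integral_sub hfi (hFi q)]
    have := norm_integral_le_of_norm_le_const (μ := P) (C := 1 / ((q : ℝ) + 1))
      (f := fun ω => f ω - F q ω) (Eventually.of_forall fun ω => hFf q ω)
    simpa using this
  filter_upwards [ae_all_iff.2 hFt] with ω hω
  rw [Metric.tendsto_atTop]
  intro ε hε
  obtain ⟨q, hq⟩ := exists_nat_one_div_lt (show (0 : ℝ) < ε / 3 by positivity)
  obtain ⟨N, hN⟩ := Metric.tendsto_atTop.1 (hω q) (ε / 3) (by positivity)
  refine ⟨N, fun n hn => ?_⟩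
  have h1 := hN n hn
  have h2 := hint q
  have h3 : |(∑ j ∈ Finset.range n, f (shift^[j] ω)) / (n : ℝ) -
      (∑ j ∈ Finset.range n, F q (shift^[j] ω)) / (n : ℝ)| ≤ 1 / ((q : ℝ) + 1) := by
    rw [← sub_div, ← Finset.sum_sub_distrib, abs_div, Nat.abs_cast]
    rcases Nat.eq_zero_or_pos n with h0 | h0
    · subst h0; simp; positivity
    rw [div_le_iff₀ (by exact_mod_cast h0)]
    calc _ ≤ ∑ j ∈ Finset.range n, |f (shift^[j] ω) - F q (shift^[j] ω)| :=
          Finset.abs_sum_le_sum_abs _ _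
      _ ≤ ∑ j ∈ Finset.range n, 1 / ((q : ℝ) + 1) := Finset.sum_le_sum fun j _ => hFf q _
      _ = _ := by rw [Finset.sum_const, Finset.card_range, nsmul_eq_mul, mul_comm]
  rw [Real.dist_eq] at h1 ⊢
  rw [abs_lt] at h1 ⊢
  rw [abs_le] at h2 h3
  constructor <;> linarith [h1.1, h1.2, h2.1, h2.2, h3.1, h3.2]

lemma le_tvDist (μ ν : Measure ℝ) [IsProbabilityMeasure μ] [IsProbabilityMeasure ν] {A : Set ℝ}
    (hA : MeasurableSet A) : |μ.real A - ν.real A| ≤ tvDist μ ν := by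
  have gen : ∀ (μ ν : Measure ℝ) [IsProbabilityMeasure μ] [IsProbabilityMeasure ν],
      BddAbove (range fun A : {A : Set ℝ // MeasurableSet A} =>
        ((μ A).toReal - (ν A).toReal)) := by
    intro μ ν _ _
    refine ⟨1, ?_⟩
    rintro _ ⟨B, rfl⟩
    have h1 : (μ (B : Set ℝ)).toReal ≤ 1 := measureReal_le_one
    have h2 : 0 ≤ (ν (B : Set ℝ)).toReal := ENNReal.toReal_nonneg
    simp only; linarith
  have a1 := le_ciSup (gen μ ν) ⟨A, hA⟩
  have a2 := le_ciSup (gen ν μ) ⟨A, hA⟩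
  have b1 := le_ciSup (gen μ ν) ⟨∅, MeasurableSet.empty⟩
  have b2 := le_ciSup (gen ν μ) ⟨∅, MeasurableSet.empty⟩
  simp only [measure_empty, ENNReal.toReal_zero, sub_zero] at b1 b2
  unfold tvDist Measure.real
  rw [abs_le]
  simp only at a1 a2
  constructor <;> linarith

/-- the decay rate is eventually dominated by a power `> 2`. -/
lemma tau_le {g : ℝ} (hg : 0 < g) (hg3 : g < 1 / 3) : ∃ β : ℝ, 2 < β ∧
    ∀ᶠ N : ℕ in atTop, (N : ℝ) ^ (1 - 1 / g) * (Real.log N) ^ (1 / g) ≤ (N : ℝ) ^ (-β) := by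
  have h3 : 3 < 1 / g := by
    rw [lt_div_iff₀ hg]; linarith
  refine ⟨(1 / g - 1 + 2) / 2, by linarith, ?_⟩
  have h1 := (isLittleO_log_rpow_rpow_atTop (1 / g)
    (show 0 < 1 / g - 1 - (1 / g - 1 + 2) / 2 by linarith)).bound (c := 1) one_pos
  have h2 := tendsto_natCast_atTop_atTop (R := ℝ) |>.eventually h1
  filter_upwards [h2, eventually_ge_atTop 1] with N hN hN1
  have hN0 : (0 : ℝ) < N := by exact_mod_cast hN1
  rw [one_mul, Real.norm_eq_abs, Real.norm_eq_abs] at hN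
  have h4 := (le_abs_self _).trans hN
  rw [abs_of_pos (Real.rpow_pos_of_pos hN0 _)] at h4
  calc _ ≤ (N : ℝ) ^ (1 - 1 / g) * (N : ℝ) ^ (1 / g - 1 - (1 / g - 1 + 2) / 2) := by gcongr
    _ = _ := by
      rw [← Real.rpow_add hN0]; congr 1; ring

lemma tau_tendsto {g : ℝ} (hg : 0 < g) (hg3 : g < 1 / 3) :
    Tendsto (fun N : ℕ => (N : ℝ) ^ (1 - 1 / g) * (Real.log N) ^ (1 / g)) atTop (𝓝 0) := by
  obtain ⟨β, hβ, hb⟩ := tau_le hg hg3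
  have h1 : Tendsto (fun N : ℕ => (N : ℝ) ^ (-β)) atTop (𝓝 0) :=
    (tendsto_rpow_neg_atTop (by linarith)).comp tendsto_natCast_atTop_atTop
  refine squeeze_zero' (Eventually.of_forall fun N => ?_) hb h1
  have : 0 ≤ Real.log N := Real.log_natCast_nonneg N
  positivity

instance : IsProbabilityMeasure mLeb := ⟨by simp [mLeb]⟩

lemma f_unifcont {m : ℕ} (γ : Fin m → ℝ) (g a : ℝ) (hg3 : g < 1 / 3)
    (ν : Om m → Measure ℝ) (hνprob : ∀ ω, IsProbabilityMeasure (ν ω)) (h : Om m → ℝ → ℝ)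
    (D : ∀ ω, Dens g a (ν ω) (h ω)) (hg : 0 < g)
    (C : ℝ)
    (hpull : ∀ (ω : Om m) (n : ℕ), 2 ≤ n →
      tvDist (mLeb.map (randComp (fun i => lsv (γ i)) (shiftInv^[n] ω) n)) (ν ω) ≤
        C * (n : ℝ) ^ (1 - 1 / g) * (Real.log n) ^ (1 / g))
    (x0 : ℝ) (hx0 : x0 ∈ Ioo (0 : ℝ) 1) :
    ∀ ε > 0, ∃ k : ℕ, 1 ≤ k ∧ ∀ ω ω' : Om m,
      (∀ i : ℤ, -(k : ℤ) ≤ i → i < k → ω i = ω' i) → |h ω x0 - h ω' x0| ≤ ε := by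
  intro ε hε
  obtain ⟨s0, hs0, hb⟩ := osc_modulus (g := g) (a := a) hx0 (show 0 < ε / 3 by positivity)
  have hlim := (tau_tendsto hg hg3).const_mul C
  rw [mul_zero] at hlim
  have hev := hlim.eventually (gt_mem_nhds (show (0 : ℝ) < s0 * (ε / 3) by positivity))
  obtain ⟨k, hk1, hk2⟩ := (hev.and (eventually_ge_atTop 2)).exists
  refine ⟨k, by omega, fun ω ω' hωω => ?_⟩
  have hB : MeasurableSet {x | |x - x0| < s0} :=
    measurableSet_lt (by fun_prop) measurable_const
  have b1 := (D ω).ball hx0 (show 0 < ε / 3 by positivity) hs0.le hb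
  have b2 := (D ω').ball hx0 (show 0 < ε / 3 by positivity) hs0.le hb
  have hmeas := measurable_randComp (fun i => lsv (γ i)) (fun i => measurable_lsv _)
  have heq : randComp (fun i => lsv (γ i)) (shiftInv^[k] ω) k =
      randComp (fun i => lsv (γ i)) (shiftInv^[k] ω') k := by
    refine randComp_congr _ _ _ _ fun i hi => ?_
    rw [shiftInv_iterate_apply, shiftInv_iterate_apply]
    exact hωω _ (by omega) (by omega)
  have := fun ω => Measure.isProbabilityMeasure_map (μ := mLeb)
    (hmeas (shiftInv^[k] ω) k).aemeasurable
  have t1 := (le_tvDist _ (ν ω) hB).trans (hpull ω k hk2)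
  have t2 := (le_tvDist _ (ν ω') hB).trans (hpull ω' k hk2)
  rw [heq] at t1
  rw [mul_assoc] at t1 t2
  rw [abs_le] at t1 t2 b1 b2
  have hfin : s0 * |h ω x0 - h ω' x0| ≤ s0 * ε := by
    rw [← abs_of_pos hs0, ← abs_mul, abs_of_pos hs0, abs_le]
    constructor <;> nlinarith [t1.1, t1.2, t2.1, t2.2, b1.1, b1.2, b2.1, b2.2]
  exact le_of_mul_le_mul_left hfin hs0

/-! ### Part F: mixing for intervals -/

lemma smoothTransition_deriv_bound : ∃ K : ℝ, 0 ≤ K ∧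
    ∀ x : ℝ, |deriv Real.smoothTransition x| ≤ K := by
  have hc : Continuous (deriv Real.smoothTransition) :=
    (Real.smoothTransition.contDiff (n := 1)).continuous_deriv le_rfl
  obtain ⟨K, hK⟩ := (isCompact_Icc (a := (0 : ℝ)) (b := 1)).exists_bound_of_continuousOn
    hc.continuousOn
  refine ⟨max K 0, le_max_right _ _, fun x => ?_⟩
  rcases lt_or_ge x 0 with h0 | h0
  · have : Real.smoothTransition =ᶠ[𝓝 x] fun _ => 0 := by
      filter_upwards [gt_mem_nhds h0] with y hy
      exact Real.smoothTransition.zero_of_nonpos hy.le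
    rw [this.deriv_eq]; simp
  rcases lt_or_ge 1 x with h1 | h1
  · have : Real.smoothTransition =ᶠ[𝓝 x] fun _ => 1 := by
      filter_upwards [lt_mem_nhds h1] with y hy
      exact Real.smoothTransition.one_of_one_le hy.le
    rw [this.deriv_eq]; simp
  · exact (hK x ⟨h0, h1⟩).trans (le_max_left _ _)

lemma stepfun_approx (μ : Measure ℝ) [IsProbabilityMeasure μ] (c ε : ℝ) (hε : 0 < ε) {W : Set ℝ}
    (hW : MeasurableSet W) :
    |∫ x in W, Real.smoothTransition ((x - c) / ε) ∂μ - μ.real (Ioi c ∩ W)| ≤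
      μ.real (Ioc c (c + ε)) := by
  have hgm : Measurable (fun x : ℝ => Real.smoothTransition ((x - c) / ε)) := by
    have : Continuous (fun x : ℝ => Real.smoothTransition ((x - c) / ε)) :=
      Real.smoothTransition.continuous.comp (by fun_prop)
    exact this.measurable
  have hgi : Integrable (fun x : ℝ => Real.smoothTransition ((x - c) / ε)) (μ.restrict W) := by
    refine Integrable.of_bound hgm.aestronglyMeasurable 1 (Eventually.of_forall fun x => ?_)
    rw [Real.norm_eq_abs, abs_of_nonneg (Real.smoothTransition.nonneg _)]
    exact Real.smoothTransition.le_one _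
  have hii : Integrable ((Ioi c).indicator (fun _ => (1 : ℝ))) (μ.restrict W) :=
    (integrable_const _).indicator measurableSet_Ioi
  have e1 : μ.real (Ioi c ∩ W) = ∫ x in W, (Ioi c).indicator (fun _ => (1 : ℝ)) x ∂μ := by
    rw [integral_indicator_const _ measurableSet_Ioi, smul_eq_mul, mul_one,
      measureReal_restrict_apply measurableSet_Ioi]
  have e2 : μ.real (Ioc c (c + ε)) = ∫ x, (Ioc c (c + ε)).indicator (fun _ => (1 : ℝ)) x ∂μ := by
    rw [integral_indicator_const _ measurableSet_Ioc, smul_eq_mul, mul_one]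
  have hpt : ∀ x, |Real.smoothTransition ((x - c) / ε) - (Ioi c).indicator (fun _ => (1 : ℝ)) x| ≤
      (Ioc c (c + ε)).indicator (fun _ => (1 : ℝ)) x := by
    intro x
    rcases le_or_gt x c with h1 | h1
    · have : Real.smoothTransition ((x - c) / ε) = 0 :=
        Real.smoothTransition.zero_of_nonpos (div_nonpos_of_nonpos_of_nonneg (by linarith) hε.le)
      rw [this, indicator_of_notMem (by simpa using h1), indicator_of_notMem]
      · simp
      · intro h; exact absurd h.1 (not_lt.2 h1)
    · rw [indicator_of_mem (show x ∈ Ioi c from h1)]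
      rcases le_or_gt x (c + ε) with h2 | h2
      · rw [indicator_of_mem (show x ∈ Ioc c (c + ε) from ⟨h1, h2⟩), abs_le]
        have := Real.smoothTransition.nonneg ((x - c) / ε)
        have := Real.smoothTransition.le_one ((x - c) / ε)
        constructor <;> linarith
      · have : Real.smoothTransition ((x - c) / ε) = 1 := by
          apply Real.smoothTransition.one_of_one_le
          rw [le_div_iff₀ hε]; linarith
        rw [this, sub_self, abs_zero]
        exact indicator_nonneg (fun _ _ => zero_le_one) _
  have hic : Integrable ((Ioc c (c + ε)).indicator (fun _ => (1 : ℝ))) μ :=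
    (integrable_const _).indicator measurableSet_Ioc
  rw [e1, ← integral_sub hgi hii, e2]
  calc _ ≤ ∫ x in W, |Real.smoothTransition ((x - c) / ε) -
        (Ioi c).indicator (fun _ => (1 : ℝ)) x| ∂μ := abs_integral_le_integral_abs
    _ ≤ ∫ x in W, (Ioc c (c + ε)).indicator (fun _ => (1 : ℝ)) x ∂μ :=
        integral_mono (hgi.sub hii).abs hic.restrict hpt
    _ ≤ _ := setIntegral_le_integral hic
        (Eventually.of_forall fun x => indicator_nonneg (fun _ _ => zero_le_one) _)

lemma stepfun_C1norm {K : ℝ} (hK0 : 0 ≤ K) (hK : ∀ x : ℝ, |deriv Real.smoothTransition x| ≤ K)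
    (c ε : ℝ) (hε : 0 < ε) :
    C1norm (fun x => Real.smoothTransition ((x - c) / ε)) ≤ 1 + K / ε := by
  unfold C1norm
  have : Nonempty (Icc (0 : ℝ) 1) := ⟨⟨0, by simp⟩⟩
  refine add_le_add (ciSup_le fun x => ?_) (ciSup_le fun x => ?_)
  · rw [abs_of_nonneg (Real.smoothTransition.nonneg _)]
    exact Real.smoothTransition.le_one _
  · have hd : HasDerivAt (fun x => Real.smoothTransition ((x - c) / ε))
        (deriv Real.smoothTransition (((x : ℝ) - c) / ε) * (1 / ε)) x := by
      have h1 : HasDerivAt Real.smoothTransition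
          (deriv Real.smoothTransition (((x : ℝ) - c) / ε)) (((x : ℝ) - c) / ε) :=
        ((Real.smoothTransition.contDiff (n := 1)).differentiable (by simp) _).hasDerivAt
      have h2 : HasDerivAt (fun x : ℝ => (x - c) / ε) (1 / ε) x :=
        ((hasDerivAt_id (x : ℝ)).sub_const c).div_const ε
      exact h1.comp (x : ℝ) h2
    rw [hd.deriv, abs_mul, abs_of_pos (by positivity : (0 : ℝ) < 1 / ε), mul_one_div]
    gcongr
    exact hK _

lemma mix_half {m : ℕ} (γ : Fin m → ℝ) (g : ℝ) (ν : Om m → Measure ℝ)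
    (hνprob : ∀ ω, IsProbabilityMeasure (ν ω))
    (hequiv : ∀ ω : Om m, (ν ω).map (lsv (γ (ω 0))) = ν (shift ω)) (C : ℝ) (hC : 0 < C)
    (hdec : ∀ f : ℝ → ℝ, ContDiff ℝ 1 f → ∀ (ω : Om m) (N : ℕ), 2 ≤ N →
      (SignedMeasure.totalVariation
        (((ν ω).withDensityᵥ (fun x => f x - ∫ y, f y ∂(ν ω))).map
          (randComp (fun i => lsv (γ i)) ω N)) Set.univ).toReal ≤
        C * C1norm f * (N : ℝ) ^ (1 - 1 / g) * (Real.log N) ^ (1 / g))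
    {K : ℝ} (hK0 : 0 ≤ K) (hK : ∀ x : ℝ, |deriv Real.smoothTransition x| ≤ K)
    (ω : Om m) (N : ℕ) (hN : 2 ≤ N) (c ε H : ℝ) (hε : 0 < ε)
    (hH : (ν ω).real (Ioc c (c + ε)) ≤ H * ε) (V : Set ℝ) (hV : MeasurableSet V) :
    |(ν ω).real (Ioi c ∩ randComp (fun i => lsv (γ i)) ω N ⁻¹' V) -
      (ν ω).real (Ioi c) * (ν (shift^[N] ω)).real V| ≤
      2 * H * ε + C * (1 + K / ε) * ((N : ℝ) ^ (1 - 1 / g) * (Real.log N) ^ (1 / g)) := by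
  set f : ℝ → ℝ := fun x => Real.smoothTransition ((x - c) / ε) with hf
  have hfc : ContDiff ℝ 1 f := by
    have : ContDiff ℝ 1 (fun x : ℝ => (x - c) / ε) := by fun_prop
    exact (Real.smoothTransition.contDiff (n := 1)).comp this
  set R := randComp (fun i => lsv (γ i)) ω N with hR
  have hRm : Measurable R := measurable_randComp _ (fun i => measurable_lsv _) _ _
  have hW : MeasurableSet (R ⁻¹' V) := hRm hV
  have a1 := stepfun_approx (ν ω) c ε hε hW
  have a2 := stepfun_approx (ν ω) c ε hε MeasurableSet.univ
  rw [inter_univ, Measure.restrict_univ] at a2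
  have hfi : Integrable f (ν ω) := by
    refine Integrable.of_bound hfc.continuous.aestronglyMeasurable 1
      (Eventually.of_forall fun x => ?_)
    rw [Real.norm_eq_abs, abs_of_nonneg (Real.smoothTransition.nonneg _)]
    exact Real.smoothTransition.le_one _
  have hsub : Integrable (fun x => f x - ∫ y, f y ∂(ν ω)) (ν ω) := hfi.sub (integrable_const _)
  have d1 := hdec f hfc ω N hN
  have d2 := SignedMeasure.norm_le_totalVariation
    (((ν ω).withDensityᵥ (fun x => f x - ∫ y, f y ∂(ν ω))).map R) V
  rw [VectorMeasure.map_apply _ hRm hV, withDensityᵥ_apply hsub hW, integral_sub hfi.restrict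
    (integrable_const _), setIntegral_const, smul_eq_mul] at d2
  have d3 : (SignedMeasure.totalVariation
        (((ν ω).withDensityᵥ (fun x => f x - ∫ y, f y ∂(ν ω))).map R)).real V ≤
      (SignedMeasure.totalVariation
        (((ν ω).withDensityᵥ (fun x => f x - ∫ y, f y ∂(ν ω))).map R) Set.univ).toReal :=
    measureReal_mono (subset_univ _)
  have hτ : 0 ≤ (N : ℝ) ^ (1 - 1 / g) * (Real.log N) ^ (1 / g) := by
    have : 0 ≤ Real.log N := Real.log_natCast_nonneg N
    positivity
  have d4 : C * C1norm f * (N : ℝ) ^ (1 - 1 / g) * (Real.log N) ^ (1 / g) ≤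
      C * (1 + K / ε) * ((N : ℝ) ^ (1 - 1 / g) * (Real.log N) ^ (1 / g)) := by
    rw [mul_assoc (C * C1norm f)]
    gcongr
    exact stepfun_C1norm hK0 hK c ε hε
  have d5 := ((d2.trans d3).trans d1).trans d4
  rw [measure_preimage_randComp γ ν hequiv ω N V hV, Real.norm_eq_abs] at d5
  set v := (ν (shift^[N] ω)).real V
  have hv0 : 0 ≤ v := measureReal_nonneg
  have hv1 : v ≤ 1 := measureReal_le_one
  have a2' : |(∫ y, f y ∂(ν ω)) * v - (ν ω).real (Ioi c) * v| ≤ H * ε := by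
    rw [← sub_mul, abs_mul, abs_of_nonneg hv0]
    calc _ ≤ |(∫ y, f y ∂(ν ω)) - (ν ω).real (Ioi c)| * 1 := by gcongr
      _ ≤ _ := by rw [mul_one]; exact a2.trans hH
  have a1' := a1.trans hH
  rw [abs_le] at a1' a2' d5 ⊢
  constructor <;> linarith [a1'.1, a1'.2, a2'.1, a2'.2, d5.1, d5.2]

/-- The open interval of radius `s` around `x0`. -/
def bl (x0 s : ℝ) : Set ℝ := {x | |x - x0| < s}

lemma bl_meas (x0 s : ℝ) : MeasurableSet (bl x0 s) :=
  measurableSet_lt (f := fun x : ℝ => |x - x0|) (by fun_prop) measurable_const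

lemma bl_mono (x0 : ℝ) {s s' : ℝ} (h : s ≤ s') : bl x0 s ⊆ bl x0 s' :=
  fun _ hx => lt_of_lt_of_le hx h

lemma v_toReal_pos {u : ℝ} {v : ℝ≥0∞} (huv : ENNReal.ofReal u < v) (hv : v ≠ ∞) :
    0 < v.toReal := ENNReal.toReal_pos (ne_bot_of_gt huv) hv

lemma mem_piece {α L d : ℝ} (hα : 0 < α) (hL : 0 < L) (hd : 0 ≤ d) {u : ℝ} {v : ℝ≥0∞}
    (hu : 0 < u) (huv : ENNReal.ofReal u < v) :
    (u < d ^ (-α⁻¹) / L ^ α⁻¹ ∧ ENNReal.ofReal (d ^ (-α⁻¹) / L ^ α⁻¹) ≤ v) ↔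
      (d < u ^ (-α) / L ∧ ¬ d < v.toReal ^ (-α) / L) ∧ d ≠ 0 := by
  rcases hd.eq_or_lt with h0 | h0
  · subst h0
    rw [Real.zero_rpow (by simpa using hα.ne')]
    simp [hu.le, not_lt]
  have hy : d ^ (-α⁻¹) / L ^ α⁻¹ = (d * L) ^ (-α⁻¹) := by
    rw [Real.mul_rpow hd hL.le, Real.rpow_neg hL.le, div_eq_mul_inv]
  set y := d ^ (-α⁻¹) / L ^ α⁻¹ with hydef
  have hypos : 0 < y := by rw [hy]; positivity
  have hyd : y ^ (-α) = d * L := by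
    rw [hy, ← Real.rpow_mul (by positivity)]
    simp [hα.ne']
  have h1 : ∀ w, 0 < w → (w < y ↔ d < w ^ (-α) / L) := by
    intro w hw
    rw [lt_div_iff₀ hL, ← hyd, Real.rpow_lt_rpow_iff_of_neg hypos hw (by linarith)]
  rw [h1 u hu]
  have h2 : ENNReal.ofReal y ≤ v ↔ ¬ d < v.toReal ^ (-α) / L := by
    by_cases hv : v = ∞
    · subst hv
      simp [Real.zero_rpow (neg_ne_zero.mpr hα.ne'), hd]
    · rw [← h1 _ (v_toReal_pos huv hv), not_lt, ENNReal.ofReal_le_iff_le_toReal hv]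
  rw [h2]
  simp [h0.ne']

lemma rho_le {α L : ℝ} (hα : 0 < α) (hL : 0 < L) {u : ℝ} {v : ℝ≥0∞}
    (hu : 0 < u) (huv : ENNReal.ofReal u < v) : v.toReal ^ (-α) / L ≤ u ^ (-α) / L := by
  gcongr ?_ / L
  by_cases hv : v = ∞
  · subst hv
    simp [Real.zero_rpow (neg_ne_zero.mpr hα.ne')]
    positivity
  · refine Real.rpow_le_rpow_of_nonpos hu ?_ (by linarith)
    exact ((ENNReal.ofReal_lt_iff_lt_toReal hu.le hv).1 huv).le

lemma Aset_eq {α L x0 : ℝ} (hα : 0 < α) (hL : 0 < L) {q : ℕ} (u : Fin q → ℝ) (v : Fin q → ℝ≥0∞)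
    (hu : ∀ i, 0 < u i) (huv : ∀ i, ENNReal.ofReal (u i) < v i) :
    Aset α x0 (L ^ α⁻¹) u v =
      ⋃ i, (bl x0 (u i ^ (-α) / L) \ bl x0 ((v i).toReal ^ (-α) / L)) \ {x0} := by
  ext x
  simp only [Aset, memJ, phiObs, mem_ofPred_eq, mem_iUnion, mem_diff, mem_singleton_iff, bl]
  refine exists_congr fun i => ?_
  rw [mem_piece hα hL (abs_nonneg _) (hu i) (huv i)]
  simp [sub_eq_zero]

lemma Aset_meas {α L x0 : ℝ} (hα : 0 < α) (hL : 0 < L) {q : ℕ} (u : Fin q → ℝ) (v : Fin q → ℝ≥0∞)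
    (hu : ∀ i, 0 < u i) (huv : ∀ i, ENNReal.ofReal (u i) < v i) :
    MeasurableSet (Aset α x0 (L ^ α⁻¹) u v) := by
  rw [Aset_eq hα hL u v hu huv]
  exact MeasurableSet.iUnion fun i =>
    ((bl_meas _ _).diff (bl_meas _ _)).diff (measurableSet_singleton _)

lemma Aset_sub {α L x0 : ℝ} (hα : 0 < α) (hL : 0 < L) {q : ℕ} (u : Fin q → ℝ) (v : Fin q → ℝ≥0∞)
    (hu : ∀ i, 0 < u i) (huv : ∀ i, ENNReal.ofReal (u i) < v i) {s : ℝ}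
    (hs : ∀ i, u i ^ (-α) / L ≤ s) :
    Aset α x0 (L ^ α⁻¹) u v ⊆ bl x0 s := by
  rw [Aset_eq hα hL u v hu huv]
  exact iUnion_subset fun i x hx => bl_mono x0 (hs i) hx.1.1

lemma Aset_measure {α L x0 : ℝ} (hα : 0 < α) (hL : 0 < L) {q : ℕ} (u : Fin q → ℝ)
    (v : Fin q → ℝ≥0∞)
    (hu : ∀ i, 0 < u i) (huv : ∀ i, ENNReal.ofReal (u i) < v i)
    (hdis : ∀ i j, i ≠ j → ∀ y : ℝ,
          ¬((u i < y ∧ ENNReal.ofReal y ≤ v i) ∧ (u j < y ∧ ENNReal.ofReal y ≤ v j)))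
    (μ : Measure ℝ) [IsProbabilityMeasure μ] (hμ : μ {x0} = 0) (V : Set ℝ) (hV : MeasurableSet V) :
    μ.real (Aset α x0 (L ^ α⁻¹) u v ∩ V) =
      ∑ i, (μ.real (bl x0 (u i ^ (-α) / L) ∩ V) -
        μ.real (bl x0 ((v i).toReal ^ (-α) / L) ∩ V)) := by
  have hpd : Pairwise (fun i j => Disjoint
      ((bl x0 (u i ^ (-α) / L) \ bl x0 ((v i).toReal ^ (-α) / L)) \ {x0} ∩ V)
      ((bl x0 (u j ^ (-α) / L) \ bl x0 ((v j).toReal ^ (-α) / L)) \ {x0} ∩ V)) := by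
    intro i j hij
    rw [Set.disjoint_left]
    rintro x ⟨hx, -⟩ ⟨hx2, -⟩
    refine hdis i j hij (|x - x0| ^ (-α⁻¹) / L ^ α⁻¹) ⟨?_, ?_⟩
    · rw [mem_piece hα hL (abs_nonneg _) (hu i) (huv i)]
      exact ⟨hx.1, by simpa [sub_eq_zero] using hx.2⟩
    · rw [mem_piece hα hL (abs_nonneg _) (hu j) (huv j)]
      exact ⟨hx2.1, by simpa [sub_eq_zero] using hx.2⟩
  rw [Aset_eq hα hL u v hu huv, iUnion_inter, measureReal_def, measure_iUnion hpd (fun i =>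
    (((bl_meas _ _).diff (bl_meas _ _)).diff (measurableSet_singleton _)).inter hV),
    tsum_fintype, ENNReal.toReal_sum (fun i _ => measure_ne_top _ _)]
  refine Finset.sum_congr rfl fun i _ => ?_
  change μ.real _ = _
  have e : (bl x0 (u i ^ (-α) / L) \ bl x0 ((v i).toReal ^ (-α) / L)) \ {x0} ∩ V =
    ((bl x0 (u i ^ (-α) / L) ∩ V) \ (bl x0 ((v i).toReal ^ (-α) / L) ∩ V)) \ {x0} := by
    ext x; simp only [mem_inter_iff, mem_diff]; tauto
  rw [e, measureReal_def, measure_diff_null hμ, ← measureReal_def,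
    measureReal_diff (inter_subset_inter_left _ (bl_mono x0 (rho_le hα hL (hu i) (huv i))))
      ((bl_meas _ _).inter hV)]

lemma bl_measure (μ : Measure ℝ) [IsProbabilityMeasure μ] (hμ : ∀ x, μ {x} = 0) (x0 : ℝ) {s : ℝ}
    (hs : 0 ≤ s) (V : Set ℝ) (hV : MeasurableSet V) :
    μ.real (bl x0 s ∩ V) = μ.real (Ioi (x0 - s) ∩ V) - μ.real (Ioi (x0 + s) ∩ V) := by
  have e : bl x0 s ∩ V = ((Ioi (x0 - s) ∩ V) \ (Ioi (x0 + s) ∩ V)) \ {x0 + s} := by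
    ext x
    simp only [bl, mem_inter_iff, mem_diff, mem_Ioi, mem_singleton_iff, mem_ofPred_eq, abs_lt]
    constructor
    · rintro ⟨⟨h1, h2⟩, h3⟩
      exact ⟨⟨⟨by linarith, h3⟩, fun h => by linarith [h.1]⟩, fun h => by linarith⟩
    · rintro ⟨⟨⟨h1, h3⟩, h2⟩, h4⟩
      refine ⟨⟨by linarith, ?_⟩, h3⟩
      have : x ≤ x0 + s := not_lt.1 fun h => h2 ⟨h, h3⟩
      have := lt_of_le_of_ne this h4
      linarith
  rw [e, measureReal_def, measure_diff_null (hμ _), ← measureReal_def,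
    measureReal_diff (inter_subset_inter_left _ (Ioi_subset_Ioi (by linarith)))
      (measurableSet_Ioi.inter hV)]

lemma mix_A {m : ℕ} (γ : Fin m → ℝ) (g a : ℝ) (ν : Om m → Measure ℝ)
    (hνprob : ∀ ω, IsProbabilityMeasure (ν ω)) (h : Om m → ℝ → ℝ)
    (D : ∀ ω, Dens g a (ν ω) (h ω))
    (hequiv : ∀ ω : Om m, (ν ω).map (lsv (γ (ω 0))) = ν (shift ω)) (C : ℝ) (hC : 0 < C)
    (hdec : ∀ f : ℝ → ℝ, ContDiff ℝ 1 f → ∀ (ω : Om m) (N : ℕ), 2 ≤ N →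
      (SignedMeasure.totalVariation
        (((ν ω).withDensityᵥ (fun x => f x - ∫ y, f y ∂(ν ω))).map
          (randComp (fun i => lsv (γ i)) ω N)) Set.univ).toReal ≤
        C * C1norm f * (N : ℝ) ^ (1 - 1 / g) * (Real.log N) ^ (1 / g))
    {K : ℝ} (hK0 : 0 ≤ K) (hK : ∀ x : ℝ, |deriv Real.smoothTransition x| ≤ K)
    (ω : Om m) (N : ℕ) (hN : 2 ≤ N) (ε δ : ℝ) (hε : 0 < ε) (hδ : 0 < δ)
    {α L x0 : ℝ} (hα : 0 < α) (hL : 0 < L) {q : ℕ} (u : Fin q → ℝ)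
    (v : Fin q → ℝ≥0∞)
    (hu : ∀ i, 0 < u i) (huv : ∀ i, ENNReal.ofReal (u i) < v i)
    (hdis : ∀ i j, i ≠ j → ∀ y : ℝ,
          ¬((u i < y ∧ ENNReal.ofReal y ≤ v i) ∧ (u j < y ∧ ENNReal.ofReal y ≤ v j)))
    (hx0 : ∀ i, δ ≤ x0 - u i ^ (-α) / L)
    (V : Set ℝ) (hV : MeasurableSet V) :
    |(ν ω).real (Aset α x0 (L ^ α⁻¹) u v ∩ randComp (fun i => lsv (γ i)) ω N ⁻¹' V) -
      (ν ω).real (Aset α x0 (L ^ α⁻¹) u v) * (ν (shift^[N] ω)).real V| ≤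
      q * (4 * (2 * (a * δ ^ (-g)) * ε +
        C * (1 + K / ε) * ((N : ℝ) ^ (1 - 1 / g) * (Real.log N) ^ (1 / g)))) := by
  haveI := hνprob ω
  set E := 2 * (a * δ ^ (-g)) * ε +
        C * (1 + K / ε) * ((N : ℝ) ^ (1 - 1 / g) * (Real.log N) ^ (1 / g)) with hE
  set Wv := randComp (fun i => lsv (γ i)) ω N ⁻¹' V with hWdef
  have hW : MeasurableSet Wv := measurable_randComp _ (fun i => measurable_lsv _) _ _ hV
  set p := (ν (shift^[N] ω)).real V with hp
  have hhalf : ∀ c, δ ≤ c → |(ν ω).real (Ioi c ∩ Wv) - (ν ω).real (Ioi c) * p| ≤ E := by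
    intro c hc
    refine mix_half γ g ν hνprob hequiv C hC hdec hK0 hK ω N hN c ε _ hε ?_ V hV
    have := (D ω).Ioc_le hδ hc (by linarith : c ≤ c + ε)
    simpa using this
  have hb : ∀ s, 0 ≤ s → δ ≤ x0 - s →
      |(ν ω).real (bl x0 s ∩ Wv) - (ν ω).real (bl x0 s) * p| ≤ 2 * E := by
    intro s hs hsδ
    have e1 := bl_measure (ν ω) (D ω).singleton x0 hs Wv hW
    have e2 := bl_measure (ν ω) (D ω).singleton x0 hs univ MeasurableSet.univ
    simp only [inter_univ] at e2
    rw [e1, e2]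
    have h1 := abs_le.1 (hhalf (x0 - s) hsδ)
    have h2 := abs_le.1 (hhalf (x0 + s) (by linarith))
    rw [abs_le]
    constructor <;> nlinarith [h1.1, h1.2, h2.1, h2.2]
  have e1 := Aset_measure hα hL u v hu huv hdis (ν ω) ((D ω).singleton x0) Wv hW
  have e2 := Aset_measure hα hL u v hu huv hdis (ν ω) ((D ω).singleton x0) univ MeasurableSet.univ
  simp only [inter_univ] at e2
  rw [e1, e2, Finset.sum_mul, ← Finset.sum_sub_distrib]
  refine (Finset.abs_sum_le_sum_abs _ _).trans ?_
  calc _ ≤ ∑ i : Fin q, 4 * E := by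
        refine Finset.sum_le_sum fun i _ => ?_
        have hr := rho_le hα hL (hu i) (huv i)
        have h1 := abs_le.1 (hb (u i ^ (-α) / L) (by have := hu i; positivity) (hx0 i))
        have h2 := abs_le.1 (hb ((v i).toReal ^ (-α) / L) (by positivity)
          (by have := hx0 i; linarith))
        rw [abs_le]
        constructor <;> nlinarith [h1.1, h1.2, h2.1, h2.2]
    _ = _ := by simp

/-- No visit to `A` during the first `r` steps. -/
def qset {m : ℕ} (T : Fin m → ℝ → ℝ) (A : Set ℝ) (ω : Om m) (r : ℕ) : Set ℝ :=
  {x | ∀ j < r, randComp T ω j x ∉ A}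

/-- Points which visit `A` at some time in `[1,t)`. -/
def wset {m : ℕ} (T : Fin m → ℝ → ℝ) (A : Set ℝ) (ω : Om m) (t : ℕ) : Set ℝ :=
  ⋃ i ∈ Finset.Ico 1 t, randComp T ω i ⁻¹' A

lemma qset_meas {m : ℕ} (T : Fin m → ℝ → ℝ) (hT : ∀ i, Measurable (T i)) (A : Set ℝ)
    (hA : MeasurableSet A) (ω : Om m) (r : ℕ) : MeasurableSet (qset T A ω r) := by
  have : qset T A ω r = ⋂ j ∈ Finset.range r, (randComp T ω j ⁻¹' A)ᶜ := by
    ext x; simp [qset]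
  rw [this]
  exact Finset.measurableSet_biInter _ fun i _ => (measurable_randComp T hT ω i hA).compl

lemma wset_meas {m : ℕ} (T : Fin m → ℝ → ℝ) (hT : ∀ i, Measurable (T i)) (A : Set ℝ)
    (hA : MeasurableSet A) (ω : Om m) (r : ℕ) : MeasurableSet (wset T A ω r) :=
  Finset.measurableSet_biUnion _ fun i _ => (measurable_randComp T hT ω i hA)

lemma surv_step {m : ℕ} (γ : Fin m → ℝ) (ν : Om m → Measure ℝ)
    (hνprob : ∀ ω, IsProbabilityMeasure (ν ω))
    (hequiv : ∀ ω : Om m, (ν ω).map (lsv (γ (ω 0))) = ν (shift ω))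
    (A : Set ℝ) (hA : MeasurableSet A) (t : ℕ) (ht : 1 ≤ t) (M : ℝ) (ω : Om m)
    (hM : ∀ V, MeasurableSet V →
      |(ν ω).real (A ∩ randComp (fun i => lsv (γ i)) ω t ⁻¹' V) -
        (ν ω).real A * (ν (shift^[t] ω)).real V| ≤ M) (r : ℕ) :
    |(ν ω).real (qset (fun i => lsv (γ i)) A ω (r + 1)) -
      (1 - (ν ω).real A) * (ν (shift ω)).real (qset (fun i => lsv (γ i)) A (shift ω) r)| ≤
      M + (ν ω).real (A ∩ wset (fun i => lsv (γ i)) A ω t) +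
        (ν ω).real A * ∑ i ∈ Finset.Ico 1 t, (ν (shift^[i] ω)).real A := by
  have := hνprob ω
  set T := fun i => lsv (γ i) with hT
  have hTm : ∀ i, Measurable (T i) := fun i => measurable_lsv _
  set U := randComp T ω 1 ⁻¹' qset T A (shift ω) r with hU
  set Q := qset T A (shift^[t] ω) (r + 1 - t) with hQ
  set V := randComp T ω t ⁻¹' Q with hV
  have hQm : MeasurableSet Q := qset_meas T hTm A hA _ _
  have hVm : MeasurableSet V := measurable_randComp T hTm _ _ hQm
  have hUm : MeasurableSet U := measurable_randComp T hTm _ _ (qset_meas T hTm A hA _ _)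
  have memU : ∀ x, x ∈ U ↔ ∀ i < r, randComp T ω (1 + i) x ∉ A := by
    intro x
    simp only [hU, mem_preimage, qset, mem_ofPred_eq]
    refine forall_congr' fun i => ?_
    rw [randComp_add]
    simp
  have memV : ∀ x, x ∈ V ↔ ∀ i < r + 1 - t, randComp T ω (t + i) x ∉ A := by
    intro x
    simp only [hV, hQ, mem_preimage, qset, mem_ofPred_eq]
    refine forall_congr' fun i => ?_
    rw [randComp_add]
  have hUV : U ⊆ V := by
    intro x hx
    rw [memU] at hx
    rw [memV]
    intro i hi
    have := hx (t + i - 1) (by omega)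
    rwa [show 1 + (t + i - 1) = t + i by omega] at this
  have hdiff : V \ U ⊆ wset T A ω t := by
    rintro x ⟨hxV, hxU⟩
    rw [memU] at hxU
    rw [memV] at hxV
    push Not at hxU
    obtain ⟨i, hi, hxA⟩ := hxU
    simp only [wset, mem_iUnion, Finset.mem_Ico, mem_preimage]
    refine ⟨1 + i, ⟨by omega, ?_⟩, hxA⟩
    by_contra hlt
    apply hxV (1 + i - t) (by omega)
    rwa [show t + (1 + i - t) = 1 + i by omega]
  have hQU : qset T A ω (r + 1) = U \ (A ∩ U) := by
    ext x
    rw [Set.mem_sdiff, mem_inter_iff, memU]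
    simp only [qset, mem_ofPred_eq]
    constructor
    · intro hx
      refine ⟨fun i hi => hx (1 + i) (by omega), fun hh => hx 0 (by omega) hh.1⟩
    · rintro ⟨h1, h2⟩ j hj
      rcases j with _ | j
      · exact fun h => h2 ⟨h, h1⟩
      · have := h1 j (by omega)
        rwa [add_comm] at this
  have e0 : (ν ω).real (qset T A ω (r + 1)) = (ν ω).real U - (ν ω).real (A ∩ U) := by
    rw [hQU, measureReal_sdiff inter_subset_right (hA.inter hUm)]
  have e1 : (ν ω).real U = (ν (shift ω)).real (qset T A (shift ω) r) := by
    have := measure_preimage_randComp γ ν hequiv ω 1 _ (qset_meas T hTm A hA (shift ω) r)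
    simpa using this
  have e2 : (ν ω).real V = (ν (shift^[t] ω)).real Q :=
    measure_preimage_randComp γ ν hequiv ω t _ hQm
  have h3 := abs_le.1 (hM Q hQm)
  rw [← e2] at h3
  have h4 : (ν ω).real (A ∩ V) ≤ (ν ω).real (A ∩ U) + (ν ω).real (A ∩ wset T A ω t) := by
    refine (measureReal_mono ?_).trans (measureReal_union_le _ _)
    intro x hx
    by_cases hxU : x ∈ U
    · exact Or.inl ⟨hx.1, hxU⟩
    · exact Or.inr ⟨hx.1, hdiff ⟨hx.2, hxU⟩⟩
  have h5 : (ν ω).real (A ∩ U) ≤ (ν ω).real (A ∩ V) :=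
    measureReal_mono (inter_subset_inter_right _ hUV)
  have h6 : (ν ω).real U ≤ (ν ω).real V := measureReal_mono hUV
  have h7 : (ν ω).real V ≤ (ν ω).real U + ∑ i ∈ Finset.Ico 1 t, (ν (shift^[i] ω)).real A := by
    have h8 : (ν ω).real (wset T A ω t) ≤ ∑ i ∈ Finset.Ico 1 t, (ν (shift^[i] ω)).real A := by
      refine (measureReal_biUnion_finset_le _ _).trans (Finset.sum_le_sum fun i _ => ?_)
      exact (measure_preimage_randComp γ ν hequiv ω i _ hA).le
    have h9 : (ν ω).real V ≤ (ν ω).real U + (ν ω).real (wset T A ω t) := by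
      refine (measureReal_mono ?_).trans (measureReal_union_le _ _)
      intro x hx
      by_cases hxU : x ∈ U
      · exact Or.inl hxU
      · exact Or.inr (hdiff ⟨hx, hxU⟩)
    linarith
  have ha : 0 ≤ (ν ω).real A := measureReal_nonneg
  rw [e0, ← e1]
  have h10 := mul_le_mul_of_nonneg_left h6 ha
  have h11 := mul_le_mul_of_nonneg_left h7 ha
  have h12 : 0 ≤ (ν ω).real (A ∩ wset T A ω t) := measureReal_nonneg
  have h13 : (0 : ℝ) ≤ ∑ i ∈ Finset.Ico 1 t, (ν (shift^[i] ω)).real A :=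
    Finset.sum_nonneg fun _ _ => measureReal_nonneg
  have h14 := mul_nonneg ha h13
  rw [abs_le]
  constructor <;> nlinarith [h3.1, h3.2]

lemma surv_prod {m : ℕ} (S : Om m → ℕ → ℝ) (a e : Om m → ℝ) (h0 : ∀ ω, S ω 0 = 1)
    (ha0 : ∀ ω, 0 ≤ a ω) (ha1 : ∀ ω, a ω ≤ 1)
    (hstep : ∀ ω r, |S ω (r + 1) - (1 - a ω) * S (shift ω) r| ≤ e ω) (r : ℕ) :
    ∀ ω, |S ω r - ∏ j ∈ Finset.range r, (1 - a (shift^[j] ω))| ≤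
      ∑ j ∈ Finset.range r, e (shift^[j] ω) := by
  induction r with
  | zero => intro ω; simp [h0]
  | succ r ih =>
    intro ω
    rw [Finset.prod_range_succ', Finset.sum_range_succ']
    simp only [Function.iterate_succ_apply, Function.iterate_zero, id]
    have h1 := ih (shift ω)
    have h2 := hstep ω r
    set p := ∏ j ∈ Finset.range r, (1 - a (shift^[j] (shift ω)))
    have h3 : |(1 - a ω) * (S (shift ω) r - p)| ≤
        ∑ j ∈ Finset.range r, e (shift^[j] (shift ω)) := by
      rw [abs_mul]
      have h4 : |1 - a ω| ≤ 1 := by rw [abs_le]; constructor <;> linarith [ha0 ω, ha1 ω]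
      calc _ ≤ 1 * |S (shift ω) r - p| := by gcongr
        _ ≤ _ := by simpa using h1
    calc _ = |(S ω (r + 1) - (1 - a ω) * S (shift ω) r) + (1 - a ω) * (S (shift ω) r - p)| := by
          congr 1; ring
      _ ≤ _ := (abs_add_le _ _).trans (by linarith)

lemma prod_exp (a : ℕ → ℕ → ℝ) (M Λ : ℝ) (h0 : ∀ n j, 0 ≤ a n j)
    (hM : ∀ᶠ n : ℕ in atTop, ∀ j < n, a n j ≤ M / n)
    (hs : Tendsto (fun n : ℕ => ∑ j ∈ Finset.range n, a n j) atTop (𝓝 Λ)) :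
    Tendsto (fun n : ℕ => ∏ j ∈ Finset.range n, (1 - a n j)) atTop (𝓝 (Real.exp (-Λ))) := by
  have hM2 : Tendsto (fun n : ℕ => M / (n : ℝ)) atTop (𝓝 0) :=
    tendsto_const_nhds.div_atTop tendsto_natCast_atTop_atTop
  have hsmall : ∀ᶠ n : ℕ in atTop, M / (n : ℝ) < 1 / 2 :=
    hM2.eventually (gt_mem_nhds (by norm_num))
  have up : Tendsto (fun n : ℕ => Real.exp (-∑ j ∈ Finset.range n, a n j)) atTop
      (𝓝 (Real.exp (-Λ))) := (Real.continuous_exp.tendsto _).comp hs.neg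
  have lo : Tendsto (fun n : ℕ => Real.exp (-((∑ j ∈ Finset.range n, a n j) * (1 + 2 * (M / n)))))
      atTop (𝓝 (Real.exp (-Λ))) := by
    have := (hs.mul ((hM2.const_mul 2).const_add 1)).neg
    simp only [mul_zero, add_zero, mul_one] at this
    exact (Real.continuous_exp.tendsto _).comp this
  refine tendsto_of_tendsto_of_tendsto_of_le_of_le' lo up ?_ ?_
  · filter_upwards [hM, hsmall] with n h1 h2
    rw [Finset.sum_mul, ← Finset.sum_neg_distrib, Real.exp_sum]
    refine Finset.prod_le_prod (fun _ _ => (Real.exp_pos _).le) fun j hj => ?_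
    have hj' := h1 j (Finset.mem_range.1 hj)
    have hj0 := h0 n j
    set y := a n j
    have hy : y ≤ 1 / 2 := by linarith
    have h3 : -(y * (1 + 2 * (M / n))) ≤ -(y + 2 * y ^ 2) := by nlinarith
    refine (Real.exp_le_exp.2 h3).trans ?_
    rw [Real.exp_neg, inv_le_comm₀ (Real.exp_pos _) (by linarith)]
    have h4 := Real.add_one_le_exp (y + 2 * y ^ 2)
    refine le_trans ?_ h4
    rw [inv_le_iff_one_le_mul₀ (by linarith)]
    nlinarith [mul_nonneg hj0 hj0, mul_nonneg (mul_nonneg hj0 hj0) (by linarith : (0:ℝ) ≤ 1 - 2 * y)]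
  · filter_upwards [hM, hsmall] with n h1 h2
    rw [← Finset.sum_neg_distrib, Real.exp_sum]
    refine Finset.prod_le_prod (fun j hj => ?_) fun j hj => ?_
    · have hj' := h1 j (Finset.mem_range.1 hj)
      linarith
    · have := Real.add_one_le_exp (-a n j)
      linarith

lemma params (τ : ℕ → ℝ) (hτ0 : ∀ N, 0 ≤ τ N) {β : ℝ} (hβ : 2 < β)
    (hτ : ∀ᶠ N : ℕ in atTop, τ N ≤ (N : ℝ) ^ (-β)) :
    ∃ (t : ℕ → ℕ) (ε : ℕ → ℝ), Monotone t ∧ (∀ n, 2 ≤ t n) ∧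
      (Summable fun l : ℕ => (t (2 ^ (l + 1)) : ℝ) / 2 ^ l) ∧
      Tendsto (fun n : ℕ => (t n : ℝ) / n) atTop (𝓝 0) ∧
      (∀ n, 1 ≤ n → 0 < ε n) ∧
      Tendsto (fun n : ℕ => (n : ℝ) * ε n) atTop (𝓝 0) ∧
      ∀ K, 0 ≤ K → Tendsto (fun n : ℕ => (n : ℝ) * ((1 + K / ε n) * τ (t n))) atTop (𝓝 0) := by
  set s := 1 / β + 1 / 2 with hs
  have hβ0 : 0 < β := by linarith
  have hs0 : 0 < s := by positivity
  have hs1 : s < 1 := by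
    have : 1 / β < 1 / 2 := by
      apply one_div_lt_one_div_of_lt <;> linarith
    linarith
  have hsβ : s * β = 1 + β / 2 := by rw [hs]; field_simp
  set η := (s * β - 2) / 2 with hη
  have hη0 : 0 < η := by rw [hη, hsβ]; linarith
  have hnat : Tendsto (fun n : ℕ => (n : ℝ)) atTop atTop := tendsto_natCast_atTop_atTop
  set t : ℕ → ℕ := fun n => ⌈(n : ℝ) ^ s⌉₊ + 2 with ht
  have htle : ∀ n, (t n : ℝ) ≤ (n : ℝ) ^ s + 3 := by
    intro n
    have := (Nat.ceil_lt_add_one (show 0 ≤ (n : ℝ) ^ s by positivity)).le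
    simp only [ht]; push_cast; linarith
  have htge : ∀ n : ℕ, (n : ℝ) ^ s ≤ t n := by
    intro n
    have := Nat.le_ceil ((n : ℝ) ^ s)
    simp only [ht]; push_cast; linarith
  have hpow : ∀ r : ℝ, r < 0 → Tendsto (fun n : ℕ => (n : ℝ) ^ r) atTop (𝓝 0) := by
    intro r hr
    have := (tendsto_rpow_neg_atTop (y := -r) (by linarith)).comp hnat
    simpa [Function.comp_def] using this
  have htinf : Tendsto t atTop atTop := by
    have h1 : Tendsto (fun n : ℕ => (n : ℝ) ^ s) atTop atTop := (tendsto_rpow_atTop hs0).comp hnat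
    have h2 : Tendsto (fun n : ℕ => (t n : ℝ)) atTop atTop := tendsto_atTop_mono htge h1
    exact tendsto_natCast_atTop_iff.1 h2
  have hτt : ∀ᶠ n : ℕ in atTop, τ (t n) ≤ (n : ℝ) ^ (-(s * β)) := by
    filter_upwards [htinf.eventually hτ, eventually_ge_atTop 1] with n h1 h2
    have hn : (0 : ℝ) < n := by exact_mod_cast h2
    refine h1.trans ?_
    calc (t n : ℝ) ^ (-β) ≤ ((n : ℝ) ^ s) ^ (-β) :=
          Real.rpow_le_rpow_of_nonpos (by positivity) (htge n) (by linarith)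
      _ = _ := by rw [← Real.rpow_mul hn.le]; congr 1; ring
  refine ⟨t, fun n => (n : ℝ) ^ (-(1 + η)), ?_, fun n => by simp [ht], ?_, ?_, ?_, ?_, ?_⟩
  · intro n n' hnn
    simp only [ht]
    gcongr
  · have h1 : Summable (fun l : ℕ => 2 * ((2 : ℝ) ^ (s - 1)) ^ l + 3 * (1 / 2 : ℝ) ^ l) := by
      refine (Summable.mul_left _ (summable_geometric_of_lt_one (by positivity) ?_)).add
        (Summable.mul_left _ (summable_geometric_of_lt_one (by norm_num) (by norm_num)))
      exact Real.rpow_lt_one_of_one_lt_of_neg (by norm_num) (by linarith)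
    refine Summable.of_nonneg_of_le (fun l => by positivity) (fun l => ?_) h1
    rw [div_le_iff₀ (by positivity)]
    refine (htle _).trans ?_
    push_cast
    have e1 : ((2 : ℝ) ^ (l + 1)) ^ s = 2 ^ s * ((2 : ℝ) ^ s) ^ l := by
      rw [← Real.rpow_natCast_mul (by norm_num), mul_comm, Real.rpow_mul_natCast (by norm_num)]
      rw [pow_succ, mul_comm]
    have e2 : ((2 : ℝ) ^ (s - 1)) ^ l * 2 ^ l = ((2 : ℝ) ^ s) ^ l := by
      rw [← mul_pow]
      congr 1
      rw [Real.rpow_sub_one (by norm_num)]; ring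
    have e3 : (1 / 2 : ℝ) ^ l * 2 ^ l = 1 := by
      rw [← mul_pow]; norm_num
    have e4 : (2 : ℝ) ^ s ≤ 2 := by
      calc (2 : ℝ) ^ s ≤ 2 ^ (1 : ℝ) := Real.rpow_le_rpow_of_exponent_le (by norm_num) hs1.le
        _ = 2 := by simp
    rw [e1, add_mul, mul_assoc, e2, mul_assoc, e3, mul_one]
    gcongr
  · have h1 : Tendsto (fun n : ℕ => (n : ℝ) ^ (s - 1) + 3 / n) atTop (𝓝 (0 + 0)) :=
      (hpow _ (by linarith)).add (tendsto_const_nhds.div_atTop hnat)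
    rw [add_zero] at h1
    refine squeeze_zero' (Eventually.of_forall fun n => by positivity) ?_ h1
    filter_upwards [eventually_ge_atTop 1] with n h2
    have hn : (0 : ℝ) < n := by exact_mod_cast h2
    rw [Real.rpow_sub_one hn.ne', ← add_div]
    gcongr
    exact htle n
  · intro n hn
    have hn : (0 : ℝ) < n := by exact_mod_cast hn
    positivity
  · refine (hpow (-η) (by linarith)).congr' ?_
    filter_upwards [eventually_ge_atTop 1] with n h2
    have hn : (0 : ℝ) < n := by exact_mod_cast h2
    rw [← Real.rpow_one_add' hn.le (by linarith)]
    congr 1; ring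
  · intro K hK
    have h1 : Tendsto (fun n : ℕ => (n : ℝ) ^ (1 - s * β) + K * (n : ℝ) ^ (-η)) atTop
        (𝓝 (0 + K * 0)) :=
      (hpow _ (by rw [hsβ]; linarith)).add ((hpow _ (by linarith)).const_mul K)
    rw [mul_zero, add_zero] at h1
    refine squeeze_zero' ?_ ?_ h1
    · filter_upwards with n
      have := hτ0 (t n)
      positivity
    filter_upwards [eventually_ge_atTop 1, hτt] with n h2 h3
    have hn : (0 : ℝ) < n := by exact_mod_cast h2
    calc (n : ℝ) * ((1 + K / (n : ℝ) ^ (-(1 + η))) * τ (t n)) ≤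
        (n : ℝ) * ((1 + K / (n : ℝ) ^ (-(1 + η))) * (n : ℝ) ^ (-(s * β))) := by gcongr
      _ = _ := by
        have e1 : (n : ℝ) ^ (1 - s * β) = n * (n : ℝ) ^ (-(s * β)) := by
          rw [sub_eq_add_neg, Real.rpow_add hn, Real.rpow_one]
        have e2 : (n : ℝ) ^ (-η) = n * (n : ℝ) ^ (1 + η) * (n : ℝ) ^ (-(s * β)) := by
          rw [← Real.rpow_one_add' hn.le (by linarith), ← Real.rpow_add hn]
          congr 1; rw [hη]; ring
        rw [e1, e2, Real.rpow_neg hn.le (1 + η), div_inv_eq_mul]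
        ring

lemma sum_ball {m : ℕ} (g a : ℝ) (ν : Om m → Measure ℝ)
    (hνprob : ∀ ω, IsProbabilityMeasure (ν ω)) (h : Om m → ℝ → ℝ)
    (D : ∀ ω, Dens g a (ν ω) (h ω)) (x0 : ℝ) (hx0 : x0 ∈ Ioo (0 : ℝ) 1) (F : ℝ) (ω : Om m)
    (hF : Tendsto (fun n : ℕ => (∑ j ∈ Finset.range n, h (shift^[j] ω) x0) / n) atTop (𝓝 F))
    (s : ℝ) (hs : 0 ≤ s) :
    Tendsto (fun n : ℕ => ∑ j ∈ Finset.range n, (ν (shift^[j] ω)).real (bl x0 (s / n))) atTop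
      (𝓝 (2 * s * F)) := by
  have hnat : Tendsto (fun n : ℕ => (n : ℝ)) atTop atTop := tendsto_natCast_atTop_atTop
  have h1 := hF.const_mul (2 * s)
  suffices hd : Tendsto (fun n : ℕ => ∑ j ∈ Finset.range n, (ν (shift^[j] ω)).real (bl x0 (s / n)) -
      2 * s * ((∑ j ∈ Finset.range n, h (shift^[j] ω) x0) / n)) atTop (𝓝 0) by
    have := hd.add h1
    simpa using this
  rw [Metric.tendsto_nhds]
  intro e he
  have hη : 0 < e / (4 * (s + 1)) := by positivity
  obtain ⟨s0, hs0, hs1⟩ := osc_modulus (g := g) (a := a) hx0 hη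
  have hsm : ∀ᶠ n : ℕ in atTop, s / (n : ℝ) < s0 :=
    (tendsto_const_nhds.div_atTop hnat).eventually (gt_mem_nhds hs0)
  filter_upwards [hsm, eventually_ge_atTop 1] with n h2 h3
  have hn : (0 : ℝ) < n := by exact_mod_cast h3
  rw [Real.dist_eq, sub_zero, Finset.sum_div, Finset.mul_sum, ← Finset.sum_sub_distrib]
  refine lt_of_le_of_lt (Finset.abs_sum_le_sum_abs _ _) ?_
  calc _ ≤ ∑ j ∈ Finset.range n, 2 * (e / (4 * (s + 1))) * (s / n) := by
        refine Finset.sum_le_sum fun j _ => ?_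
        have := hνprob (shift^[j] ω)
        have h4 := (D (shift^[j] ω)).ball hx0 hη (div_nonneg hs hn.le)
          (fun x hx => hs1 x (hx.trans h2))
        refine le_trans (le_of_eq ?_) h4
        unfold bl
        congr 2
        ring
    _ = e * (s / (2 * (s + 1))) := by
        simp only [Finset.sum_const, Finset.card_range, nsmul_eq_mul]
        field_simp
        ring
    _ < e * 1 := by
        gcongr
        rw [div_lt_one (by positivity)]
        linarith
    _ = e := mul_one e

lemma b_limit {m : ℕ} (g a : ℝ) (ν : Om m → Measure ℝ)
    (hνprob : ∀ ω, IsProbabilityMeasure (ν ω)) (h : Om m → ℝ → ℝ)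
    (D : ∀ ω, Dens g a (ν ω) (h ω)) (x0 : ℝ) (hx0 : x0 ∈ Ioo (0 : ℝ) 1)
    (P : Measure (Om m)) [IsProbabilityMeasure P]
    (νa : Measure ℝ) (hνa : ∀ A : Set ℝ, MeasurableSet A → νa A = ∫⁻ ω, ν ω A ∂P)
    (hi : Integrable (fun ω => h ω x0) P) :
    Tendsto (fun ε : ℝ => (νa {x | |x - x0| < ε}).toReal / ε) (𝓝[>] (0 : ℝ))
      (𝓝 (2 * ∫ ω, h ω x0 ∂P)) := by
  set F := ∫ ω, h ω x0 ∂P with hF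
  rw [Metric.tendsto_nhds]
  intro e he
  have hη : 0 < e / 4 := by positivity
  obtain ⟨s0, hs0, hs1⟩ := osc_modulus (g := g) (a := a) hx0 hη
  filter_upwards [Ioo_mem_nhdsGT hs0] with ε hε
  have hε0 : 0 < ε := hε.1
  have hball : ∀ ω, |(ν ω).real (bl x0 ε) - 2 * ε * h ω x0| ≤ 2 * (e / 4) * ε := by
    intro ω
    have := hνprob ω
    exact (D ω).ball hx0 hη hε0.le (fun x hx => hs1 x (hx.trans hε.2))
  have hval : νa (bl x0 ε) = ∫⁻ ω, ENNReal.ofReal ((ν ω).real (bl x0 ε)) ∂P := by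
    rw [hνa _ (bl_meas _ _)]
    refine lintegral_congr fun ω => ?_
    have := hνprob ω
    rw [ofReal_measureReal]
  have hup : νa (bl x0 ε) ≤ ENNReal.ofReal (2 * ε * (F + e / 4)) := by
    rw [hval]
    have : 2 * ε * (F + e / 4) = ∫ ω, (2 * ε * h ω x0 + 2 * (e / 4) * ε) ∂P := by
      rw [integral_add (hi.const_mul _) (integrable_const _), integral_const_mul]
      simp; ring
    rw [this, ofReal_integral_eq_lintegral_ofReal]
    · refine lintegral_mono fun ω => ENNReal.ofReal_le_ofReal ?_
      linarith [(abs_le.1 (hball ω)).2]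
    · exact (hi.const_mul _).add (integrable_const _)
    · refine Eventually.of_forall fun ω => ?_
      have := (D ω).nonneg x0
      simp only [Pi.zero_apply]
      positivity
  have hlo : ENNReal.ofReal (2 * ε * (F - e / 4)) ≤ νa (bl x0 ε) := by
    rw [hval]
    have : 2 * ε * (F - e / 4) = ∫ ω, (2 * ε * h ω x0 - 2 * (e / 4) * ε) ∂P := by
      rw [integral_sub (hi.const_mul _) (integrable_const _), integral_const_mul]
      simp; ring
    rw [this]
    refine (ENNReal.ofReal_le_ofReal (integral_mono (g := fun ω =>
      max (2 * ε * h ω x0 - 2 * (e / 4) * ε) 0) ?_ ?_ fun ω => le_max_left _ _)).trans ?_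
    · exact (hi.const_mul _).sub (integrable_const _)
    · exact ((hi.const_mul _).sub (integrable_const _)).pos_part
    rw [ofReal_integral_eq_lintegral_ofReal]
    · refine lintegral_mono fun ω => ENNReal.ofReal_le_ofReal ?_
      refine max_le ?_ measureReal_nonneg
      linarith [(abs_le.1 (hball ω)).1]
    · exact ((hi.const_mul _).sub (integrable_const _)).pos_part
    · exact Eventually.of_forall fun ω => le_max_right _ _
  have hfin : νa (bl x0 ε) ≠ ∞ := ne_top_of_le_ne_top ENNReal.ofReal_ne_top hup
  have hF0 : 0 ≤ F := integral_nonneg fun ω => (D ω).nonneg x0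
  have r1 : (νa (bl x0 ε)).toReal ≤ 2 * ε * (F + e / 4) :=
    ENNReal.toReal_le_of_le_ofReal (by positivity) hup
  have r2 : 2 * ε * (F - e / 4) ≤ (νa (bl x0 ε)).toReal :=
    (ENNReal.ofReal_le_iff_le_toReal hfin).1 hlo
  change dist ((νa (bl x0 ε)).toReal / ε) (2 * F) < e
  rw [Real.dist_eq, abs_lt]
  constructor
  · rw [lt_sub_iff_add_lt, lt_div_iff₀ hε0]
    nlinarith
  · rw [sub_lt_iff_lt_add, div_lt_iff₀ hε0]
    nlinarith

lemma bl_vol (x0 s : ℝ) : volume (bl x0 s) = ENNReal.ofReal (2 * s) := by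
  have : bl x0 s = Metric.ball x0 s := by
    ext x; simp [bl, Real.dist_eq]
  rw [this, Real.volume_ball]

lemma visits_limit {m : ℕ} (g a : ℝ) (ν : Om m → Measure ℝ)
    (hνprob : ∀ ω, IsProbabilityMeasure (ν ω)) (h : Om m → ℝ → ℝ)
    (D : ∀ ω, Dens g a (ν ω) (h ω)) (x0 : ℝ) (hx0 : x0 ∈ Ioo (0 : ℝ) 1) (F : ℝ) (hF0 : 0 < F)
    (ω : Om m)
    (hF : Tendsto (fun n : ℕ => (∑ j ∈ Finset.range n, h (shift^[j] ω) x0) / n) atTop (𝓝 F))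
    {α : ℝ} (hα : 0 < α) {q : ℕ} (u : Fin q → ℝ) (v : Fin q → ℝ≥0∞)
    (hu : ∀ i, 0 < u i) (huv : ∀ i, ENNReal.ofReal (u i) < v i)
    (hdis : ∀ i j, i ≠ j → ∀ y : ℝ,
          ¬((u i < y ∧ ENNReal.ofReal y ≤ v i) ∧ (u j < y ∧ ENNReal.ofReal y ≤ v j))) :
    Tendsto (fun n : ℕ => ∑ j ∈ Finset.range n,
      (ν (shift^[j] ω)).real (Aset α x0 ((2 * F * (n : ℝ)) ^ α⁻¹) u v)) atTop
      (𝓝 (PiAlpha α u v)) := by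
  have key : Tendsto (fun n : ℕ => ∑ i, (∑ j ∈ Finset.range n,
      (ν (shift^[j] ω)).real (bl x0 ((u i ^ (-α) / (2 * F)) / n)) -
      ∑ j ∈ Finset.range n,
      (ν (shift^[j] ω)).real (bl x0 (((v i).toReal ^ (-α) / (2 * F)) / n)))) atTop
      (𝓝 (∑ i, (2 * (u i ^ (-α) / (2 * F)) * F - 2 * ((v i).toReal ^ (-α) / (2 * F)) * F))) := by
    refine tendsto_finsetSum _ fun i _ => ?_
    refine (sum_ball g a ν hνprob h D x0 hx0 F ω hF _ ?_).sub
      (sum_ball g a ν hνprob h D x0 hx0 F ω hF _ ?_)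
    · have := hu i
      positivity
    · positivity
  have e : PiAlpha α u v =
      ∑ i, (2 * (u i ^ (-α) / (2 * F)) * F - 2 * ((v i).toReal ^ (-α) / (2 * F)) * F) := by
    unfold PiAlpha
    refine Finset.sum_congr rfl fun i _ => ?_
    field_simp
  rw [e]
  refine key.congr' ?_
  filter_upwards [eventually_ge_atTop 1] with n hn
  have hn : (0 : ℝ) < n := by exact_mod_cast hn
  have hj : ∀ j, (ν (shift^[j] ω)).real (Aset α x0 ((2 * F * (n : ℝ)) ^ α⁻¹) u v) =
      ∑ i, ((ν (shift^[j] ω)).real (bl x0 ((u i ^ (-α) / (2 * F)) / n)) -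
        (ν (shift^[j] ω)).real (bl x0 (((v i).toReal ^ (-α) / (2 * F)) / n))) := by
    intro j
    have := hνprob (shift^[j] ω)
    have h1 := Aset_measure (x0 := x0) hα (by positivity : 0 < 2 * F * (n : ℝ)) u v hu huv hdis
      (ν (shift^[j] ω)) ((D _).singleton x0) univ MeasurableSet.univ
    simp only [inter_univ] at h1
    rw [h1]
    simp only [div_div]
  simp only [hj]
  rw [Finset.sum_comm]
  simp only [Finset.sum_sub_distrib]

lemma surv_limit {m : ℕ} (γ : Fin m → ℝ) (g a : ℝ) (ν : Om m → Measure ℝ)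
    (hνprob : ∀ ω, IsProbabilityMeasure (ν ω)) (h : Om m → ℝ → ℝ)
    (D : ∀ ω, Dens g a (ν ω) (h ω))
    (hequiv : ∀ ω : Om m, (ν ω).map (lsv (γ (ω 0))) = ν (shift ω)) (C : ℝ) (hC : 0 < C)
    (hdec : ∀ f : ℝ → ℝ, ContDiff ℝ 1 f → ∀ (ω : Om m) (N : ℕ), 2 ≤ N →
      (SignedMeasure.totalVariation
        (((ν ω).withDensityᵥ (fun x => f x - ∫ y, f y ∂(ν ω))).map
          (randComp (fun i => lsv (γ i)) ω N)) Set.univ).toReal ≤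
        C * C1norm f * (N : ℝ) ^ (1 - 1 / g) * (Real.log N) ^ (1 / g))
    (t : ℕ → ℕ) (ε : ℕ → ℝ) (htm : Monotone t) (ht2 : ∀ n, 2 ≤ t n)
    (htn : Tendsto (fun n : ℕ => (t n : ℝ) / n) atTop (𝓝 0))
    (hε : ∀ n, 1 ≤ n → 0 < ε n)
    (hεn : Tendsto (fun n : ℕ => (n : ℝ) * ε n) atTop (𝓝 0))
    (hτn : ∀ K, 0 ≤ K → Tendsto (fun n : ℕ => (n : ℝ) * ((1 + K / ε n) *
      ((t n : ℝ) ^ (1 - 1 / g) * (Real.log (t n)) ^ (1 / g)))) atTop (𝓝 0))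
    (x0 : ℝ) (ω : Om m)
    {α b : ℝ} (hα : 0 < α) (hb : 0 < b) {q : ℕ} (u : Fin q → ℝ) (v : Fin q → ℝ≥0∞)
    (hu : ∀ i, 0 < u i) (huv : ∀ i, ENNReal.ofReal (u i) < v i)
    (hdis : ∀ i j, i ≠ j → ∀ y : ℝ,
          ¬((u i < y ∧ ENNReal.ofReal y ≤ v i) ∧ (u j < y ∧ ENNReal.ofReal y ≤ v j)))
    (R δ : ℝ) (hR : 0 < R) (hRu : ∀ i, u i ^ (-α) / b ≤ R) (hδ : 0 < δ) (hδx : δ < x0)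
    (hret : Tendsto (fun l : ℕ => ∑ j ∈ Finset.range (2 ^ (l + 1)),
      volume ({x | |x - x0| < R / 2 ^ l} ∩
        badS (fun i => lsv (γ i)) δ (2 * (R / 2 ^ l)) (t (2 ^ (l + 1))) (shift^[j] ω)))
      atTop (𝓝 0)) (Λ : ℝ)
    (hΛ : Tendsto (fun n : ℕ => ∑ j ∈ Finset.range n,
      (ν (shift^[j] ω)).real (Aset α x0 ((b * (n : ℝ)) ^ α⁻¹) u v)) atTop (𝓝 Λ)) :
    Tendsto (fun n : ℕ => (ν ω).real
      (qset (fun i => lsv (γ i)) (Aset α x0 ((b * (n : ℝ)) ^ α⁻¹) u v) ω n)) atTop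
      (𝓝 (Real.exp (-Λ))) := by
  obtain ⟨K, hK0, hK⟩ := smoothTransition_deriv_bound
  set T := fun i => lsv (γ i) with hT
  have hTm : ∀ i, Measurable (T i) := fun i => measurable_lsv _
  set A : ℕ → Set ℝ := fun n => Aset α x0 ((b * (n : ℝ)) ^ α⁻¹) u v with hA
  have hnat : Tendsto (fun n : ℕ => (n : ℝ)) atTop atTop := tendsto_natCast_atTop_atTop
  set H := a * δ ^ (-g) with hH
  have ha := (D ω).ha
  have hH0 : 0 < H := by positivity
  have hAm : ∀ n, 1 ≤ n → MeasurableSet (A n) := fun n hn =>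
    Aset_meas hα (by have : (0 : ℝ) < n := by exact_mod_cast hn
                     positivity) u v hu huv
  have hrho : ∀ n : ℕ, 1 ≤ n → ∀ i, u i ^ (-α) / (b * n) ≤ R / n := by
    intro n hn i
    rw [← div_div]
    gcongr
    exact hRu i
  have hAsub : ∀ n : ℕ, 1 ≤ n → A n ⊆ bl x0 (R / n) := fun n hn =>
    Aset_sub hα (by have : (0 : ℝ) < n := by exact_mod_cast hn
                    positivity) u v hu huv (hrho n hn)
  have hev : ∀ᶠ n : ℕ in atTop, R / (n : ℝ) < x0 - δ :=
    (tendsto_const_nhds.div_atTop hnat).eventually (gt_mem_nhds (by linarith))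
  -- smallness of the target
  have hAbound : ∀ᶠ n : ℕ in atTop, ∀ ω', (ν ω').real (A n) ≤ (2 * H * R) / n := by
    filter_upwards [hev, eventually_ge_atTop 1] with n h1 h2 ω'
    have hn : (0 : ℝ) < n := by exact_mod_cast h2
    refine ((D ω').real_le hδ (hAm n h2) fun x hx => ?_).trans ?_
    · have := abs_lt.1 (show |x - x0| < R / n from hAsub n h2 hx)
      simp only [mem_Ioi]
      linarith [this.1]
    · have : (volume (A n ∩ Icc 0 1)).toReal ≤ 2 * (R / n) := by
        refine ENNReal.toReal_le_of_le_ofReal (by positivity) ?_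
        rw [← bl_vol x0]
        exact measure_mono (inter_subset_left.trans (hAsub n h2))
      calc H * (volume (A n ∩ Icc 0 1)).toReal ≤ H * (2 * (R / n)) := by gcongr
        _ = _ := by ring
  have hprod := prod_exp (fun n j => (ν (shift^[j] ω)).real (A n)) (2 * H * R) Λ
    (fun _ _ => measureReal_nonneg) (hAbound.mono fun n hn j _ => hn _) hΛ
  -- the return term
  set I : ℕ → ℝ≥0∞ := fun l => ∑ j ∈ Finset.range (2 ^ (l + 1)),
      volume ({x | |x - x0| < R / 2 ^ l} ∩
        badS T δ (2 * (R / 2 ^ l)) (t (2 ^ (l + 1))) (shift^[j] ω)) with hI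
  have hIfin : ∀ l j, volume ({x | |x - x0| < R / 2 ^ l} ∩
        badS T δ (2 * (R / 2 ^ l)) (t (2 ^ (l + 1))) (shift^[j] ω)) ≠ ∞ := by
    intro l j
    refine ne_top_of_le_ne_top ?_ (measure_mono inter_subset_left)
    change volume (bl x0 _) ≠ ∞
    rw [bl_vol]
    exact ENNReal.ofReal_ne_top
  have hlog : Tendsto (fun n : ℕ => Nat.log 2 n) atTop atTop := by
    refine tendsto_atTop.2 fun k => ?_
    filter_upwards [eventually_ge_atTop (2 ^ k)] with n hn
    exact Nat.le_log_of_pow_le (by norm_num) hn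
  have hIlim : Tendsto (fun n : ℕ => H * (I (Nat.log 2 n)).toReal) atTop (𝓝 0) := by
    have h1 : Tendsto (fun l => (I l).toReal) atTop (𝓝 0) := by
      have := (ENNReal.tendsto_toReal (ENNReal.zero_ne_top)).comp hret
      simpa [Function.comp_def] using this
    simpa using (h1.comp hlog).const_mul H
  have hretn : ∀ᶠ n : ℕ in atTop, ∑ j ∈ Finset.range n,
      (ν (shift^[j] ω)).real (A n ∩ wset T (A n) (shift^[j] ω) (t n)) ≤
        H * (I (Nat.log 2 n)).toReal := by
    filter_upwards [hev, eventually_ge_atTop 1] with n h1 h2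
    have hn : (0 : ℝ) < n := by exact_mod_cast h2
    set l := Nat.log 2 n with hl
    have hl1 : 2 ^ l ≤ n := Nat.pow_log_le_self 2 (by omega)
    have hl2 : n < 2 ^ (l + 1) := Nat.lt_pow_succ_log_self (by norm_num) n
    have hl1' : R / n ≤ R / 2 ^ l := by
      gcongr
      exact_mod_cast hl1
    have hterm : ∀ j, (ν (shift^[j] ω)).real (A n ∩ wset T (A n) (shift^[j] ω) (t n)) ≤
        H * (volume ({x | |x - x0| < R / 2 ^ l} ∩
        badS T δ (2 * (R / 2 ^ l)) (t (2 ^ (l + 1))) (shift^[j] ω))).toReal := by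
      intro j
      refine ((D (shift^[j] ω)).real_le hδ ((hAm n h2).inter
        (wset_meas T hTm _ (hAm n h2) _ _)) fun x hx => ?_).trans ?_
      · have := abs_lt.1 (show |x - x0| < R / n from hAsub n h2 hx.1)
        simp only [mem_Ioi]
        linarith [this.1]
      · refine mul_le_mul_of_nonneg_left (ENNReal.toReal_mono (hIfin l j) (measure_mono ?_)) hH0.le
        rintro x ⟨⟨hxA, hxW⟩, hx01⟩
        have hxb : |x - x0| < R / n := hAsub n h2 hxA
        have hxδ : δ < x := by linarith [(abs_lt.1 hxb).1]
        simp only [wset, mem_iUnion, Finset.mem_Ico, mem_preimage] at hxW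
        obtain ⟨i, ⟨hi1, hit⟩, hiA⟩ := hxW
        have hib : |randComp T (shift^[j] ω) i x - x0| < R / n := hAsub n h2 hiA
        refine ⟨lt_of_lt_of_le hxb hl1', ⟨by linarith, hx01.2⟩, hxδ, i, hi1,
          lt_of_lt_of_le hit (htm hl2.le), ?_⟩
        rw [abs_lt] at hxb hib ⊢
        constructor <;> linarith [hxb.1, hxb.2, hib.1, hib.2]
    calc _ ≤ ∑ j ∈ Finset.range n, H * (volume ({x | |x - x0| < R / 2 ^ l} ∩
        badS T δ (2 * (R / 2 ^ l)) (t (2 ^ (l + 1))) (shift^[j] ω))).toReal :=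
          Finset.sum_le_sum fun j _ => hterm j
      _ ≤ ∑ j ∈ Finset.range (2 ^ (l + 1)), H * (volume ({x | |x - x0| < R / 2 ^ l} ∩
        badS T δ (2 * (R / 2 ^ l)) (t (2 ^ (l + 1))) (shift^[j] ω))).toReal := by
          refine Finset.sum_le_sum_of_subset_of_nonneg
            (Finset.range_mono hl2.le) fun j _ _ => by positivity
      _ = H * (I l).toReal := by
          rw [hI, ENNReal.toReal_sum (fun j _ => hIfin l j), Finset.mul_sum]
  -- total error
  set Mn : ℕ → ℝ := fun n => q * (4 * (2 * H * ε n +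
        C * (1 + K / ε n) * ((t n : ℝ) ^ (1 - 1 / g) * (Real.log (t n)) ^ (1 / g)))) with hMn
  set Er : ℕ → ℝ := fun n => n * Mn n + H * (I (Nat.log 2 n)).toReal +
    (2 * H * R) * (2 * H * R) * ((t n : ℝ) / n) with hEr
  have hErlim : Tendsto Er atTop (𝓝 0) := by
    have h1 : Tendsto (fun n : ℕ => n * Mn n) atTop (𝓝 0) := by
      have := ((hεn.const_mul (2 * H)).add ((hτn K hK0).const_mul C)).const_mul ((q : ℝ) * 4)
      simp only [mul_zero, add_zero] at this
      refine this.congr fun n => ?_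
      rw [hMn]; ring
    have := (h1.add hIlim).add (htn.const_mul ((2 * H * R) * (2 * H * R)))
    simpa using this
  have hbd : ∀ᶠ n : ℕ in atTop, |(ν ω).real (qset T (A n) ω n) -
      ∏ j ∈ Finset.range n, (1 - (ν (shift^[j] ω)).real (A n))| ≤ Er n := by
    filter_upwards [hev, eventually_ge_atTop 1, hAbound, hretn] with n h1 h2 h3 h4
    have hn : (0 : ℝ) < n := by exact_mod_cast h2
    have hp := surv_prod (fun ω r => (ν ω).real (qset T (A n) ω r)) (fun ω => (ν ω).real (A n))
      (fun ω => Mn n + (ν ω).real (A n ∩ wset T (A n) ω (t n)) +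
        (ν ω).real (A n) * ∑ i ∈ Finset.Ico 1 (t n), (ν (shift^[i] ω)).real (A n))
      (fun ω => by
        have := hνprob ω
        have e : qset T (A n) ω 0 = univ := by ext x; simp [qset]
        simp only [e, probReal_univ])
      (fun ω => measureReal_nonneg)
      (fun ω => by
        have := hνprob ω
        exact measureReal_le_one)
      (fun ω' r => surv_step γ ν hνprob hequiv (A n) (hAm n h2) (t n) (by have := ht2 n; omega)
        (Mn n) ω' (fun V hV => mix_A γ g a ν hνprob h D hequiv C hC hdec hK0 hK ω' (t n) (ht2 n)
          (ε n) δ (hε n h2) hδ hα (by positivity) u v hu huv hdis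
          (fun i => by have := hrho n h2 i; linarith) V hV) r) n ω
    refine hp.trans ?_
    rw [Finset.sum_add_distrib, Finset.sum_add_distrib, Finset.sum_const, Finset.card_range,
      nsmul_eq_mul]
    refine add_le_add (add_le_add le_rfl h4) ?_
    calc _ ≤ ∑ j ∈ Finset.range n, (2 * H * R / n) * (t n * (2 * H * R / n)) := by
          refine Finset.sum_le_sum fun j _ => ?_
          refine mul_le_mul (h3 _) ?_ (Finset.sum_nonneg fun _ _ => measureReal_nonneg)
            (by positivity)
          refine (Finset.sum_le_card_nsmul _ _ (2 * H * R / n) fun i _ => h3 _).trans ?_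
          rw [Nat.card_Ico, nsmul_eq_mul]
          gcongr
          omega
      _ = _ := by
          simp only [Finset.sum_const, Finset.card_range, nsmul_eq_mul]
          field_simp
  have hdiff : Tendsto (fun n : ℕ => (ν ω).real (qset T (A n) ω n) -
      ∏ j ∈ Finset.range n, (1 - (ν (shift^[j] ω)).real (A n))) atTop (𝓝 0) :=
    squeeze_zero_norm' hbd hErlim
  have := hdiff.add hprod
  simpa using this

theorem stmt14 (m : ℕ) (hm : 1 ≤ m)
    (γ : Fin m → ℝ) (hγ : ∀ i, γ i ∈ Set.Ioo (0 : ℝ) 1)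
    (gmax : ℝ) (hgmax1 : ∀ i, γ i ≤ gmax) (hgmax2 : ∃ i, γ i = gmax)
    (hgmax3 : gmax < 1 / 3)
    -- `P` is the Bernoulli product measure `(p_1, …, p_m)^{⊗ℤ}`
    (p : Fin m → ℝ) (hp : ∀ i, 0 < p i) (hp1 : ∑ i, p i = 1)
    (P : Measure (Om m)) (hPprob : IsProbabilityMeasure P)
    (hP : ∀ (s : Finset ℤ) (f : ℤ → Fin m),
      P {ω | ∀ i ∈ s, ω i = f i} = ENNReal.ofReal (∏ i ∈ s, p (f i)))
    -- the quenched measures `ν^ω` with densities `h_ω`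
    (ν : Om m → Measure ℝ) (hνprob : ∀ ω, IsProbabilityMeasure (ν ω))
    (h : Om m → ℝ → ℝ) (hmeas : ∀ ω, Measurable (h ω))
    (hdens : ∀ ω, ν ω = mLeb.withDensity (fun x => ENNReal.ofReal (h ω x)))
    -- (i): equivariance
    (hequiv : ∀ ω : Om m, (ν ω).map (lsv (γ (ω 0))) = ν (shift ω))
    -- (ii): the densities lie in the cone `L`
    (acone : ℝ) (hacone : 0 < acone)
    (hcone : ∀ ω, ContinuousOn (h ω) (Set.Ioc 0 1) ∧ (∀ x, 0 ≤ h ω x) ∧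
      AntitoneOn (h ω) (Set.Ioc 0 1) ∧
      MonotoneOn (fun x => x ^ (gmax + 1) * h ω x) (Set.Ioc 0 1) ∧
      ∀ x ∈ Set.Ioc (0 : ℝ) 1, h ω x ≤ acone * x ^ (-gmax))
    (C : ℝ) (hC : 0 < C)
    -- (iii): polynomial pullback approximation of `h_ω`
    (hpull : ∀ (ω : Om m) (n : ℕ), 2 ≤ n →
      tvDist (mLeb.map (randComp (fun i => lsv (γ i)) (shiftInv^[n] ω) n)) (ν ω) ≤
        C * (n : ℝ) ^ (1 - 1 / gmax) * (Real.log n) ^ (1 / gmax))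
    -- (iv): polynomial quenched decay of correlations for `C¹` observables
    (hdec : ∀ g : ℝ → ℝ, ContDiff ℝ 1 g → ∀ (ω : Om m) (N : ℕ), 2 ≤ N →
      (SignedMeasure.totalVariation
        (((ν ω).withDensityᵥ (fun x => g x - ∫ y, g y ∂(ν ω))).map
          (randComp (fun i => lsv (γ i)) ω N)) Set.univ).toReal ≤
        C * C1norm g * (N : ℝ) ^ (1 - 1 / gmax) * (Real.log N) ^ (1 / gmax))
    (α : ℝ) (hα : α ∈ Set.Ioo (0 : ℝ) 2)
    -- the annealed measure `ν(A) = ∫ ν^ω(A) d𝐏(ω)`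
    (νa : Measure ℝ)
    (hνa : ∀ A : Set ℝ, MeasurableSet A → νa A = ∫⁻ ω, ν ω A ∂P) :
    ∀ᵐ x0 ∂mLeb, ∃ b : ℝ, 0 < b ∧
      Tendsto (fun ε : ℝ => (νa {x | |x - x0| < ε}).toReal / ε) (𝓝[>] (0 : ℝ)) (𝓝 b) ∧
      ∀ (q : ℕ) (u : Fin q → ℝ) (v : Fin q → ℝ≥0∞), 1 ≤ q →
        (∀ i, 0 < u i) → (∀ i, ENNReal.ofReal (u i) < v i) →
        (∀ i j, i ≠ j → ∀ y : ℝ,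
          ¬((u i < y ∧ ENNReal.ofReal y ≤ v i) ∧ (u j < y ∧ ENNReal.ofReal y ≤ v j))) →
        ∀ᵐ ω ∂P,
          -- (a): exponential law / no point of the orbit up to time `n` lies in `A_n`
          Tendsto (fun n : ℕ =>
            ((ν ω) {x | ∀ j < n,
              randComp (fun i => lsv (γ i)) ω j x ∉
                Aset α x0 ((b * (n : ℝ)) ^ α⁻¹) u v}).toReal)
            atTop (𝓝 (Real.exp (-PiAlpha α u v))) ∧
          -- (b): convergence of the expected number of visits
          Tendsto (fun n : ℕ =>
            ∑ j ∈ Finset.range n,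
              ((ν (shift^[j] ω)) (Aset α x0 ((b * (n : ℝ)) ^ α⁻¹) u v)).toReal)
            atTop (𝓝 (PiAlpha α u v)) := by
  have hg : 0 < gmax := by
    obtain ⟨i, hi⟩ := hgmax2
    rw [← hi]
    exact (hγ i).1
  have D : ∀ ω, Dens gmax acone (ν ω) (h ω) := fun ω =>
    ⟨hg, hacone, hmeas ω, hdens ω, (hcone ω).2.1, (hcone ω).2.2.1, (hcone ω).2.2.2.1,
      (hcone ω).2.2.2.2⟩
  obtain ⟨β, hβ, hτ⟩ := tau_le hg hgmax3
  obtain ⟨t, ε, htm, ht2, hsum, htn, hε, hεn, hτn⟩ := params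
    (fun N : ℕ => (N : ℝ) ^ (1 - 1 / gmax) * (Real.log N) ^ (1 / gmax))
    (fun N => mul_nonneg (by positivity) (Real.rpow_nonneg (Real.log_natCast_nonneg N) _)) hβ hτ
  have hret : ∀ᵐ x0 : ℝ, ∀ (R d : ℕ), ∀ᵐ ω ∂P, Tendsto (fun l : ℕ =>
      ∑ j ∈ Finset.range (2 ^ (l + 1)), volume ({x | |x - x0| < ((R : ℝ) + 1) / 2 ^ l} ∩
        badS (fun i => lsv (γ i)) (1 / ((d : ℝ) + 2)) (2 * (((R : ℝ) + 1) / 2 ^ l))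
          (t (2 ^ (l + 1))) (shift^[j] ω)))
      atTop (𝓝 0) := by
    rw [ae_all_iff]
    intro R
    rw [ae_all_iff]
    intro d
    refine ae_returns γ hγ P t hsum ((R : ℝ) + 1) (by positivity) _ (by positivity) ?_
    apply one_div_le_one_div_of_le (by norm_num)
    have : (0 : ℝ) ≤ d := by positivity
    linarith
  have hret' := (Measure.absolutelyContinuous_restrict (s := Set.Icc (0 : ℝ) 1)).ae_le hret
  have hIoo : ∀ᵐ x0 ∂mLeb, x0 ∈ Set.Ioo (0 : ℝ) 1 := by
    unfold mLeb
    rw [← restrict_Ioo_eq_restrict_Icc]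
    exact ae_restrict_mem measurableSet_Ioo
  filter_upwards [hIoo, (hret' : ∀ᵐ x0 ∂mLeb, _)] with x0 hx0 hx0r
  obtain ⟨hfm, hfi, hferg⟩ := ergodic_shift hm p hp P hP (fun ω => h ω x0)
    (f_unifcont γ gmax acone hgmax3 ν hνprob h D hg C hpull x0 hx0)
  set F := ∫ ω, h ω x0 ∂P with hF
  have hpos : ∀ ω, 0 < h ω x0 := fun ω => by
    have := hνprob ω
    exact (D ω).pos hx0
  have hF0 : 0 < F := by
    rw [hF, integral_pos_iff_support_of_nonneg (fun ω => (hpos ω).le) hfi]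
    have : Function.support (fun ω => h ω x0) = Set.univ := by
      ext ω
      simp [(hpos ω).ne']
    rw [this]
    simp
  refine ⟨2 * F, by positivity, b_limit gmax acone ν hνprob h D x0 hx0 P νa hνa hfi, ?_⟩
  intro q u v hq hu huv hdis
  obtain ⟨R, hR⟩ := exists_nat_ge (∑ i, u i ^ (-α) / (2 * F))
  obtain ⟨d, hd⟩ := exists_nat_one_div_lt hx0.1
  have hRu : ∀ i, u i ^ (-α) / (2 * F) ≤ (R : ℝ) + 1 := by
    intro i
    have h1 : u i ^ (-α) / (2 * F) ≤ ∑ i, u i ^ (-α) / (2 * F) :=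
      Finset.single_le_sum (f := fun i => u i ^ (-α) / (2 * F))
        (fun i _ => by have := hu i; positivity) (Finset.mem_univ i)
    linarith
  have hδx : 1 / ((d : ℝ) + 2) < x0 := by
    refine lt_of_le_of_lt ?_ hd
    apply one_div_le_one_div_of_le (by positivity)
    linarith
  filter_upwards [hferg, hx0r R d] with ω hω1 hω2
  have hb := visits_limit gmax acone ν hνprob h D x0 hx0 F hF0 ω hω1 hα.1 u v hu huv hdis
  refine ⟨?_, hb⟩
  exact surv_limit γ gmax acone ν hνprob h D hequiv C hC hdec t ε htm ht2 htn hε hεn hτn x0 ω hα.1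
    (by positivity) u v hu huv hdis ((R : ℝ) + 1) (1 / ((d : ℝ) + 2)) (by positivity) hRu
    (by positivity) hδx hω2 _ hb
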